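/- arXiv:2504.05120 — 5 statements merged into one kernel-verified Lean document; each statement's English description precedes it below -/
import Mathlib

section
/- Let k and l be positive integers and let G = ⟨a, b | a^k = b^l⟩ be the free product of two infinite cyclic groups amalgamated over the subgroups ⟨a^k⟩ = ⟨b^l⟩. Then the intersection of the derived subgroup [G,G] with the center Z(G) is the trivial subgroup. -/
/-- The generalized Baumslag–Solitar group `⟨a, b | a^k = b^l⟩`, i.e. the free product of two
infinite cyclic groups amalgamated over `⟨a^k⟩ = ⟨b^l⟩`, presented as the quotient of the free
group on two generators by the normal closure of `a^k * b^{-l}`. -/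
abbrev GBS (k l : ℕ) : Type :=
  PresentedGroup ({FreeGroup.of 0 ^ k * (FreeGroup.of 1 ^ l)⁻¹} : Set (FreeGroup (Fin 2)))

namespace Monoid.CoprodI

variable {ι : Type*}

theorem Word.exists_eq_cons {M : ι → Type*} [∀ i, Monoid (M i)] (w : Word M)
    (hw : w ≠ Word.empty) :
    ∃ (i : ι) (m : M i) (t : Word M) (h₁ : t.fstIdx ≠ some i) (h₂ : m ≠ 1),
      w = Word.cons m t h₁ h₂ := by
  induction w using Word.consRecOn with
  | empty => exact absurd rfl hw
  | cons i m t h₁ h₂ _ => exact ⟨i, m, t, h₁, h₂, rfl⟩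

/-- A free product of at least two nontrivial groups has trivial center. -/
theorem center_eq_bot [Nontrivial ι] (G : ι → Type*) [∀ i, Group (G i)]
    [∀ i, Nontrivial (G i)] : Subgroup.center (CoprodI G) = ⊥ := by
  classical
  have prod_inj : Function.Injective (Word.prod : Word G → CoprodI G) :=
    Word.equiv.symm.injective
  refine (Subgroup.eq_bot_iff_forall _).2 fun z hz => ?_
  obtain ⟨w, rfl⟩ : ∃ w : Word G, w.prod = z := ⟨_, Word.equiv.left_inv z⟩
  by_contra hne
  have hw : w ≠ Word.empty := by
    rintro rfl
    exact hne Word.prod_empty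
  obtain ⟨i, j, v, hv⟩ := NeWord.of_word w hw
  obtain ⟨p, m, t, h₁, h₂, rfl⟩ := w.exists_eq_cons hw
  rw [Subgroup.mem_center_iff] at hz
  have append_prod (q : ι) (hq : j ≠ q) (g : G q) (hg : g ≠ 1) :
      (NeWord.append v hq (NeWord.singleton g hg)).toWord.prod =
        of g * (Word.cons m t h₁ h₂).prod := by
    change NeWord.prod _ = _
    rw [NeWord.append_prod, NeWord.prod_singleton, hz, ← hv]
    rfl
  have append_toList (q : ι) (hq : j ≠ q) (g : G q) (hg : g ≠ 1) :
      (NeWord.append v hq (NeWord.singleton g hg)).toWord.toList =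
        ⟨p, m⟩ :: t.toList ++ [⟨q, g⟩] := by
    change v.toWord.toList ++ _ = _
    rw [hv]
    rfl
  by_cases hp : j = p
  · obtain ⟨q, hq⟩ := exists_ne p
    obtain ⟨g, hg⟩ := exists_ne (1 : G q)
    have hjq : j ≠ q := hp ▸ hq.symm
    have hfst : (Word.cons m t h₁ h₂).fstIdx ≠ some q := by
      simpa using hq.symm
    have heq := prod_inj ((append_prod q hjq g hg).trans (Word.prod_cons q g _ hg hfst).symm)
    have hlist := congrArg Word.toList heq
    rw [append_toList] at hlist
    have := congrArg (fun l => l.head?.map Sigma.fst) hlist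
    simp [Word.cons] at this
    exact hq this.symm
  · have heq : (NeWord.append v hp (NeWord.singleton m⁻¹ (inv_ne_one.2 h₂))).toWord = t := by
      apply prod_inj
      rw [append_prod, Word.prod_cons, ← mul_assoc, ← map_mul, inv_mul_cancel, map_one, one_mul]
    have hlist := congrArg (fun w => w.toList.length) heq
    simp only [append_toList] at hlist
    simp at hlist
    omega

end Monoid.CoprodI

namespace GBS

variable {k l : ℕ}

/-- The generators of `GBS k l`: `gen 0` is `a` and `gen 1` is `b`. -/
abbrev gen (i : Fin 2) : GBS k l := PresentedGroup.of i

theorem gen_zero_pow : (gen 0 : GBS k l) ^ k = gen 1 ^ l := by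
  have := PresentedGroup.mk_eq_mk_of_mul_inv_mem
    (Set.mem_singleton (FreeGroup.of (0 : Fin 2) ^ k * (FreeGroup.of 1 ^ l)⁻¹))
  rw [map_pow, map_pow] at this
  exact this

/-- The homomorphism out of `GBS k l` determined by the images of the generators. -/
def lift {H : Type*} [Group H] (f : Fin 2 → H) (hf : f 0 ^ k = f 1 ^ l) : GBS k l →* H :=
  PresentedGroup.toGroup (f := f) (by
    rintro r rfl
    simp [hf])

@[simp]
theorem lift_gen {H : Type*} [Group H] (f : Fin 2 → H) (hf : f 0 ^ k = f 1 ^ l) (i : Fin 2) :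
    lift f hf (gen i) = f i :=
  PresentedGroup.toGroup.of _

theorem mem_center_of_commute {x : GBS k l} (h₀ : Commute x (gen 0)) (h₁ : Commute x (gen 1)) :
    x ∈ Subgroup.center (GBS k l) := by
  refine Subgroup.mem_center_iff.2 fun g => ?_
  refine (Subgroup.mem_centralizer_singleton_iff.1
    (PresentedGroup.generated_by _ (Subgroup.centralizer {x}) (fun i => ?_) g))
  rw [Subgroup.mem_centralizer_singleton_iff]
  fin_cases i
  exacts [h₀.eq.symm, h₁.eq.symm]

theorem gen_zero_pow_mem_center : (gen 0 : GBS k l) ^ k ∈ Subgroup.center (GBS k l) := by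
  refine mem_center_of_commute ((Commute.refl _).pow_left k) ?_
  rw [gen_zero_pow]
  exact (Commute.refl _).pow_left l

theorem commutator_eq_bot_of_commute (h : Commute (gen 0 : GBS k l) (gen 1)) :
    commutator (GBS k l) = ⊥ := by
  rw [commutator_eq_bot_iff_center_eq_top, eq_top_iff]
  refine fun x _ => PresentedGroup.generated_by _ _ (fun i => ?_) x
  fin_cases i
  exacts [mem_center_of_commute (.refl _) h, mem_center_of_commute h.symm (.refl _)]

theorem gen_notMem_zpowers (hk : k ≠ 1) (hl : l ≠ 1) (i : Fin 2) :
    (gen i : GBS k l) ∉ Subgroup.zpowers ((gen 0 : GBS k l) ^ k) := by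
  have key {H : Type} [Group H] (φ : GBS k l →* H) (h : φ (gen 0) ^ k = 1)
      (hi : φ (gen i) ≠ 1) : gen i ∉ Subgroup.zpowers ((gen 0 : GBS k l) ^ k) := by
    rintro ⟨n, hn⟩
    apply hi
    rw [← hn]
    simp [h]
  have pow_eq (n : ℕ) : (Multiplicative.ofAdd (1 : ZMod n)) ^ n = 1 := by
    simp [← ofAdd_nsmul]
  have ne_one {n : ℕ} (hn : n ≠ 1) : Multiplicative.ofAdd (1 : ZMod n) ≠ 1 := by
    have := ZMod.nontrivial_iff.2 hn
    simp
  fin_cases i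
  · exact key (lift ![Multiplicative.ofAdd (1 : ZMod k), 1] (by simp [pow_eq]))
      (by simp [pow_eq]) (by simpa using ne_one hk)
  · exact key (lift ![1, Multiplicative.ofAdd (1 : ZMod l)] (by simp [pow_eq]))
      (by simp) (by simpa using ne_one hl)

theorem center_le_zpowers (hk : k ≠ 1) (hl : l ≠ 1) :
    Subgroup.center (GBS k l) ≤ Subgroup.zpowers ((gen 0 : GBS k l) ^ k) := by
  set N := Subgroup.zpowers ((gen 0 : GBS k l) ^ k)
  have hNormal : N.Normal := by
    refine ⟨fun z hz g => ?_⟩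
    have hzc := (Subgroup.zpowers_le (H := Subgroup.center _)).2 gen_zero_pow_mem_center hz
    rwa [Subgroup.mem_center_iff.1 hzc, mul_inv_cancel_right]
  let x (i : Fin 2) : GBS k l ⧸ N := QuotientGroup.mk' N (gen i)
  have x_ne (i : Fin 2) : x i ≠ 1 := fun h =>
    gen_notMem_zpowers hk hl i ((QuotientGroup.eq_one_iff _).1 h)
  have x_zero : x 0 ^ k = 1 := by
    rw [← map_pow]
    exact (QuotientGroup.eq_one_iff _).2 (Subgroup.mem_zpowers _)
  have x_one : x 1 ^ l = 1 := by
    rw [← map_pow, ← gen_zero_pow, map_pow]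
    exact x_zero
  let y (i : Fin 2) : Subgroup.zpowers (x i) := ⟨x i, Subgroup.mem_zpowers _⟩
  have y_zero : y 0 ^ k = 1 := Subtype.ext x_zero
  have y_one : y 1 ^ l = 1 := Subtype.ext x_one
  have (i : Fin 2) : Nontrivial (Subgroup.zpowers (x i)) :=
    ⟨y i, 1, fun h => x_ne i (congrArg Subtype.val h)⟩
  let φ : GBS k l →* Monoid.CoprodI fun i => Subgroup.zpowers (x i) :=
    lift (fun i => Monoid.CoprodI.of (y i)) (by rw [← map_pow, ← map_pow, y_zero, y_one]; simp)
  let ψ : (Monoid.CoprodI fun i => Subgroup.zpowers (x i)) →* GBS k l ⧸ N :=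
    Monoid.CoprodI.lift fun i => (Subgroup.zpowers (x i)).subtype
  have ψ_comp_φ : ψ.comp φ = QuotientGroup.mk' N := by
    refine PresentedGroup.ext fun i => ?_
    change ψ (φ (gen i)) = x i
    simp [φ, ψ, y]
  have φ_surj : Function.Surjective φ := by
    intro c
    change c ∈ φ.range
    induction c using Monoid.CoprodI.induction_on with
    | one => exact one_mem _
    | mul a b ha hb => exact mul_mem ha hb
    | of i g =>
      obtain ⟨_, n, rfl⟩ := g
      refine ⟨gen i ^ n, ?_⟩
      rw [map_zpow, lift_gen, ← map_zpow]
      rfl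
  intro z hz
  have hφz : φ z ∈ Subgroup.center _ := by
    refine Subgroup.mem_center_iff.2 fun c => ?_
    obtain ⟨g, rfl⟩ := φ_surj c
    rw [← map_mul, Subgroup.mem_center_iff.1 hz, map_mul]
  rw [Monoid.CoprodI.center_eq_bot, Subgroup.mem_bot] at hφz
  refine (QuotientGroup.eq_one_iff z).1 ?_
  change QuotientGroup.mk' N z = 1
  rw [← ψ_comp_φ, MonoidHom.comp_apply, hφz, map_one]

theorem commutator_inf_zpowers_eq_bot (hk : 0 < k) (hl : 0 < l) :
    commutator (GBS k l) ⊓ Subgroup.zpowers ((gen 0 : GBS k l) ^ k) = ⊥ := by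
  refine (Subgroup.eq_bot_iff_forall _).2 ?_
  rintro _ ⟨hz, n, rfl⟩
  let φ : GBS k l →* Multiplicative ℤ :=
    lift ![Multiplicative.ofAdd (l : ℤ), Multiplicative.ofAdd (k : ℤ)]
      (Multiplicative.toAdd.injective (by simp [mul_comm]))
  have h : φ ((gen 0 ^ k) ^ n) = 1 := Abelianization.commutator_subset_ker φ hz
  have hn : n = 0 := by
    have := congrArg Multiplicative.toAdd h
    simpa [φ, hk.ne', hl.ne'] using this
  simp [hn]

end GBS

/-- For `G = ⟨a, b | a^k = b^l⟩` with `k, l` positive, the intersection of the derived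
subgroup `[G,G]` with the center `Z(G)` is trivial. -/
theorem commutator_inf_center_eq_bot (k l : ℕ) (hk : 0 < k) (hl : 0 < l) :
    commutator (GBS k l) ⊓ Subgroup.center (GBS k l) = ⊥ := by
  have rel : (GBS.gen 0 : GBS k l) ^ k = GBS.gen 1 ^ l := GBS.gen_zero_pow
  by_cases hk1 : k = 1
  · subst hk1
    rw [GBS.commutator_eq_bot_of_commute, bot_inf_eq]
    rw [(pow_one _).symm.trans rel]
    exact (Commute.refl _).pow_left l
  by_cases hl1 : l = 1
  · subst hl1
    rw [GBS.commutator_eq_bot_of_commute, bot_inf_eq]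
    rw [← rel.trans (pow_one _)]
    exact (Commute.refl _).pow_right k
  exact le_bot_iff.1 <| (inf_le_inf_left _ (GBS.center_le_zpowers hk1 hl1)).trans
    (GBS.commutator_inf_zpowers_eq_bot hk hl).le
end

section
/- Let p be a prime and let k, l, κ, λ be natural numbers with κ ≤ k, λ ≤ l and k − κ = l − λ. Let G = ⟨x, y | x^{p^k} = 1, y^{p^l} = 1, x^{p^κ} = y^{p^λ}⟩, the free product of cyclic groups of orders p^k and p^l amalgamated over the subgroups ⟨x^{p^κ}⟩ = ⟨y^{p^λ}⟩ (both cyclic of order p^{k−κ} = p^{l−λ}). Then the intersection of the derived subgroup [G,G] with the center Z(G) is trivial. -/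
/-- The fundamental group of a segment of finite cyclic `p`-groups:
`G = ⟨x, y | x^{p^k} = 1, y^{p^l} = 1, x^{p^κ} = y^{p^λ}⟩`, the free product of cyclic groups of
orders `p^k` and `p^l` amalgamated over `⟨x^{p^κ}⟩ = ⟨y^{p^λ}⟩`. -/
abbrev SegmentP (p k l κ μ : ℕ) : Type :=
  PresentedGroup ({FreeGroup.of 0 ^ p ^ k, FreeGroup.of 1 ^ p ^ l,
    FreeGroup.of 0 ^ p ^ κ * (FreeGroup.of 1 ^ p ^ μ)⁻¹} : Set (FreeGroup (Fin 2)))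

section

open Monoid Subgroup

/-- A free product of nontrivial groups with at least two factors is centerless. -/
theorem Monoid.CoprodI.center_eq_bot_s1 {ι : Type*} [Nontrivial ι] {G : ι → Type*}
    [∀ i, Group (G i)] [∀ i, Nontrivial (G i)] : center (CoprodI G) = ⊥ := by
  classical
  rw [eq_bot_iff]
  intro z hz
  rw [mem_bot]
  by_contra hne
  have hw : CoprodI.Word.equiv z ≠ CoprodI.Word.empty := fun h ↦ hne <| by
    rw [← CoprodI.Word.equiv.symm_apply_apply z, h]
    exact CoprodI.Word.prod_empty
  obtain ⟨i, j, w, hwz⟩ := CoprodI.NeWord.of_word _ hw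
  have hprod : w.prod = z := by
    rw [CoprodI.NeWord.prod, hwz]
    exact CoprodI.Word.equiv.symm_apply_apply z
  obtain ⟨m, hm⟩ := exists_ne j
  obtain ⟨a, ha⟩ := exists_ne (1 : G m)
  let s := CoprodI.NeWord.singleton a ha
  let v := (w.append hm.symm s).append hm w.inv
  have hvs : v.prod = s.prod := by
    simp only [v, CoprodI.NeWord.append_prod, CoprodI.NeWord.inv_prod, hprod]
    rw [← mem_center_iff.1 hz, mul_inv_cancel_right]
  have hlen : v.toList.length = s.toList.length :=
    congrArg (fun u : CoprodI.Word G ↦ u.toList.length)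
      (CoprodI.Word.equiv.symm.injective (a₁ := v.toWord) (a₂ := s.toWord) hvs)
  have hpos := List.length_pos_iff.2 w.toList_ne_nil
  simp only [v, s, CoprodI.NeWord.toList, List.length_append, List.length_singleton] at hlen
  omega

/-- A cyclic subgroup embedding in an abelian quotient meets the derived subgroup trivially. -/
theorem disjoint_commutator_zpowers_of_orderOf_dvd {G A : Type*} [Group G] [CommGroup A]
    (f : G →* A) {g : G} (h : orderOf g ∣ orderOf (f g)) :
    Disjoint (commutator G) (zpowers g) := by
  rw [disjoint_def]
  rintro _ hz ⟨n, rfl⟩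
  have hf : f g ^ n = 1 := by
    rw [← map_zpow]
    exact Abelianization.commutator_subset_ker f hz
  exact orderOf_dvd_iff_zpow_eq_one.1
    ((Int.natCast_dvd_natCast.2 h).trans (orderOf_dvd_iff_zpow_eq_one.2 hf))

theorem PresentedGroup.mem_center_of_commute_of {α : Type*} {rels : Set (FreeGroup α)}
    {g : PresentedGroup rels} (h : ∀ a, Commute (PresentedGroup.of a) g) :
    g ∈ center (PresentedGroup rels) := by
  have hle : closure (Set.range (PresentedGroup.of : α → PresentedGroup rels)) ≤
      centralizer {g} := by
    rw [closure_le]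
    rintro _ ⟨a, rfl⟩
    exact mem_centralizer_singleton_iff.2 (h a)
  rw [PresentedGroup.closure_range_of] at hle
  exact mem_center_iff.2 fun a ↦ mem_centralizer_singleton_iff.1 (hle (mem_top a))

/-- The homomorphism from the multiplicative cyclic group of order `n` sending the generator to an
element whose `n`-th power is trivial. -/
def zmodPowHom {G : Type*} [Group G] (n : ℕ) (g : G) (h : g ^ n = 1) :
    Multiplicative (ZMod n) →* G :=
  AddMonoidHom.toMultiplicativeLeft
    (ZMod.lift n ⟨zmultiplesHom (Additive G) (Additive.ofMul g), by
      simpa using congrArg Additive.ofMul h⟩)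

theorem zmodPowHom_ofAdd_one {G : Type*} [Group G] (n : ℕ) (g : G) (h : g ^ n = 1) :
    zmodPowHom n g h (Multiplicative.ofAdd 1) = g := by
  have := ZMod.lift_coe n (⟨zmultiplesHom (Additive G) (Additive.ofMul g), by
    simpa using congrArg Additive.ofMul h⟩ : {f : ℤ →+ Additive G // f n = 0}) 1
  simp only [Int.cast_one] at this
  simp [zmodPowHom, this]

theorem ofAdd_one_pow_eq_one {m n : ℕ} (h : n ∣ m) :
    (Multiplicative.ofAdd (1 : ZMod n)) ^ m = 1 := by
  rw [← ofAdd_nsmul, nsmul_one, (ZMod.natCast_eq_zero_iff m n).2 h, ofAdd_zero]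

theorem orderOf_dvd_orderOf_ofAdd_one {G : Type*} [Group G] {n : ℕ} {g : G} (h : g ^ n = 1) :
    orderOf g ∣ orderOf (Multiplicative.ofAdd (1 : ZMod n)) := by
  rw [orderOf_ofAdd_eq_addOrderOf, ZMod.addOrderOf_one]
  exact orderOf_dvd_of_pow_eq_one h

namespace SegmentP

variable {p k l κ μ : ℕ}

theorem of_zero_pow : (PresentedGroup.of 0 : SegmentP p k l κ μ) ^ p ^ k = 1 :=
  PresentedGroup.one_of_mem (by simp)

theorem of_one_pow : (PresentedGroup.of 1 : SegmentP p k l κ μ) ^ p ^ l = 1 :=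
  PresentedGroup.one_of_mem (by simp)

theorem of_zero_pow_eq_of_one_pow :
    (PresentedGroup.of 0 : SegmentP p k l κ μ) ^ p ^ κ = PresentedGroup.of 1 ^ p ^ μ :=
  mul_inv_eq_one.1 (PresentedGroup.one_of_mem
    (x := FreeGroup.of 0 ^ p ^ κ * (FreeGroup.of 1 ^ p ^ μ)⁻¹) (by simp))

/-- The homomorphism out of `SegmentP` determined by images of the two generators. -/
def lift {H : Type*} [Group H] (a b : H) (ha : a ^ p ^ k = 1) (hb : b ^ p ^ l = 1)
    (hab : a ^ p ^ κ = b ^ p ^ μ) : SegmentP p k l κ μ →* H :=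
  PresentedGroup.toGroup (f := ![a, b]) (by
    rintro r (rfl | rfl | rfl)
    · simpa using ha
    · simpa using hb
    · simpa [mul_inv_eq_one] using hab)

section lift

variable {H : Type*} [Group H] {a b : H} (ha : a ^ p ^ k = 1) (hb : b ^ p ^ l = 1)
  (hab : a ^ p ^ κ = b ^ p ^ μ)

theorem lift_of_zero : lift a b ha hb hab (PresentedGroup.of 0) = a :=
  PresentedGroup.toGroup.of _

theorem lift_of_one : lift a b ha hb hab (PresentedGroup.of 1) = b :=
  PresentedGroup.toGroup.of _

end lift

theorem of_zero_pow_mem_center :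
    (PresentedGroup.of 0 : SegmentP p k l κ μ) ^ p ^ κ ∈ center (SegmentP p k l κ μ) := by
  refine PresentedGroup.mem_center_of_commute_of fun i ↦ ?_
  fin_cases i
  · exact Commute.self_pow _ _
  · simp only [of_zero_pow_eq_of_one_pow]
    exact Commute.self_pow _ _

theorem center_eq_top_of_of_mem_center {i : Fin 2}
    (h : PresentedGroup.of i ∈ center (SegmentP p k l κ μ)) :
    center (SegmentP p k l κ μ) = ⊤ := by
  rw [eq_top_iff, ← PresentedGroup.closure_range_of, closure_le]
  rintro _ ⟨j, rfl⟩
  refine PresentedGroup.mem_center_of_commute_of fun a ↦ ?_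
  rcases eq_or_ne j i with rfl | hj
  · exact mem_center_iff.1 h _
  rcases eq_or_ne a i with rfl | ha
  · exact (mem_center_iff.1 h _).symm
  · obtain rfl : a = j := by omega
    exact Commute.refl _

theorem center_eq_top_of_left_eq_zero (h : κ = 0) : center (SegmentP p k l κ μ) = ⊤ := by
  have hn : p ^ κ = 1 := by rw [h, pow_zero]
  have hx : (PresentedGroup.of 0 : SegmentP p k l κ μ) ^ p ^ κ = PresentedGroup.of 0 :=
    (congrArg (_ ^ ·) hn).trans (pow_one _)
  exact center_eq_top_of_of_mem_center (hx ▸ of_zero_pow_mem_center)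

theorem center_eq_top_of_right_eq_zero (h : μ = 0) : center (SegmentP p k l κ μ) = ⊤ := by
  have hn : p ^ μ = 1 := by rw [h, pow_zero]
  have hy : (PresentedGroup.of 0 : SegmentP p k l κ μ) ^ p ^ κ = PresentedGroup.of 1 :=
    of_zero_pow_eq_of_one_pow.trans ((congrArg (_ ^ ·) hn).trans (pow_one _))
  exact center_eq_top_of_of_mem_center (hy ▸ of_zero_pow_mem_center)

/-- When neither factor is amalgamated entirely, the center is the amalgamated subgroup: the
quotient by it is a free product of two nontrivial cyclic groups. -/
theorem center_le_amalgam (hp : p.Prime) (hκ : κ ≤ k) (hμ : μ ≤ l) (hκ0 : κ ≠ 0) (hμ0 : μ ≠ 0) :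
    center (SegmentP p k l κ μ) ≤
      zpowers ((PresentedGroup.of 0 : SegmentP p k l κ μ) ^ p ^ κ) := by
  let C := zpowers ((PresentedGroup.of 0 : SegmentP p k l κ μ) ^ p ^ κ)
  have : C.Normal := ⟨fun c hc g ↦ by
    rwa [mem_center_iff.1 (zpowers_le.2 of_zero_pow_mem_center hc), mul_inv_cancel_right]⟩
  let e : Fin 2 → ℕ := ![κ, μ]
  let F : Fin 2 → Type := fun i ↦ Multiplicative (ZMod (p ^ e i))
  have he : ∀ i, e i ≠ 0 := by
    intro i
    fin_cases i
    · exact hκ0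
    · exact hμ0
  have : ∀ i, Nontrivial (F i) := fun i ↦ by
    have : Fact (1 < p ^ e i) := ⟨Nat.one_lt_pow (he i) hp.one_lt⟩
    exact inferInstanceAs (Nontrivial (Multiplicative (ZMod (p ^ e i))))
  let t : ∀ i, CoprodI F := fun i ↦ CoprodI.of (M := F) (i := i) (Multiplicative.ofAdd 1)
  have ht : ∀ i n, e i ≤ n → t i ^ p ^ n = 1 := fun i n h ↦ by
    simp only [t]
    rw [← map_pow]
    exact (congrArg _ (ofAdd_one_pow_eq_one (pow_dvd_pow p h))).trans (map_one _)
  let f : SegmentP p k l κ μ →* CoprodI F :=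
    lift (t 0) (t 1) (ht 0 k hκ) (ht 1 l hμ) ((ht 0 κ le_rfl).trans (ht 1 μ le_rfl).symm)
  have hC : ∀ i : Fin 2, (QuotientGroup.mk' C (PresentedGroup.of i)) ^ p ^ e i = 1 := by
    intro i
    rw [← map_pow]
    refine (QuotientGroup.eq_one_iff _).2 ?_
    fin_cases i
    · exact mem_zpowers _
    · change PresentedGroup.of 1 ^ p ^ μ ∈ C
      rw [← of_zero_pow_eq_of_one_pow]
      exact mem_zpowers _
  let g : CoprodI F →* SegmentP p k l κ μ ⧸ C :=
    CoprodI.lift fun i ↦ zmodPowHom (p ^ e i) _ (hC i)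
  have hgt : ∀ i, g (t i) = QuotientGroup.mk' C (PresentedGroup.of i) := fun i ↦
    (CoprodI.lift_of _ _).trans (zmodPowHom_ofAdd_one _ _ (hC i))
  have hft : ∀ i, f (PresentedGroup.of i) = t i := by
    intro i
    fin_cases i
    · exact lift_of_zero _ _ _
    · exact lift_of_one _ _ _
  have hgf : g.comp f = QuotientGroup.mk' C :=
    PresentedGroup.ext fun i ↦ (congrArg g (hft i)).trans (hgt i)
  have hf : Function.Surjective f := fun w ↦ by
    rw [← MonoidHom.mem_range]
    induction w using CoprodI.induction_on with
    | one => exact one_mem _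
    | of i m =>
      have hm : m = (Multiplicative.ofAdd (1 : ZMod (p ^ e i))) ^ (m.toAdd.cast : ℤ) := by
        rw [← ofAdd_zsmul, zsmul_one, ZMod.intCast_zmod_cast, ofAdd_toAdd]
      rw [hm, map_zpow]
      exact Subgroup.zpow_mem f.range ⟨_, hft i⟩ _
    | mul a b ha hb => exact mul_mem ha hb
  intro z hz
  have hfz : f z = 1 := by
    rw [← mem_bot, ← CoprodI.center_eq_bot_s1 (G := F), mem_center_iff]
    intro w
    obtain ⟨w, rfl⟩ := hf w
    rw [← map_mul, ← map_mul, mem_center_iff.1 hz]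
  refine (QuotientGroup.eq_one_iff z).1 ?_
  change QuotientGroup.mk' C z = 1
  rw [← hgf, MonoidHom.comp_apply, hfz, map_one]

/-- The amalgamated subgroup embeds in the abelianization, since the larger cyclic factor does. -/
theorem disjoint_commutator_amalgam (hκ : κ ≤ k) (hμ : μ ≤ l) (hdiff : k - κ = l - μ) :
    Disjoint (commutator (SegmentP p k l κ μ))
      (zpowers ((PresentedGroup.of 0 : SegmentP p k l κ μ) ^ p ^ κ)) := by
  rcases le_total κ μ with h | h
  · let f : SegmentP p k l κ μ →* Multiplicative (ZMod (p ^ l)) :=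
      lift (Multiplicative.ofAdd 1 ^ p ^ (μ - κ)) (Multiplicative.ofAdd 1)
        (by rw [← pow_mul, ← pow_add]; exact ofAdd_one_pow_eq_one (pow_dvd_pow p (by omega)))
        (ofAdd_one_pow_eq_one dvd_rfl) (by rw [← pow_mul, ← pow_add, Nat.sub_add_cancel h])
    have hf : f (PresentedGroup.of 1) = Multiplicative.ofAdd 1 := lift_of_one _ _ _
    refine (disjoint_commutator_zpowers_of_orderOf_dvd f
      (hf ▸ orderOf_dvd_orderOf_ofAdd_one of_one_pow)).mono_right ?_
    rw [zpowers_le, of_zero_pow_eq_of_one_pow]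
    exact npow_mem_zpowers _ _
  · let f : SegmentP p k l κ μ →* Multiplicative (ZMod (p ^ k)) :=
      lift (Multiplicative.ofAdd 1) (Multiplicative.ofAdd 1 ^ p ^ (κ - μ))
        (ofAdd_one_pow_eq_one dvd_rfl)
        (by rw [← pow_mul, ← pow_add]; exact ofAdd_one_pow_eq_one (pow_dvd_pow p (by omega)))
        (by rw [← pow_mul, ← pow_add, Nat.sub_add_cancel h])
    have hf : f (PresentedGroup.of 0) = Multiplicative.ofAdd 1 := lift_of_zero _ _ _
    refine (disjoint_commutator_zpowers_of_orderOf_dvd f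
      (hf ▸ orderOf_dvd_orderOf_ofAdd_one of_zero_pow)).mono_right ?_
    rw [zpowers_le]
    exact npow_mem_zpowers _ _

end SegmentP

end

/-- For the fundamental group `G` of a segment of finite cyclic `p`-groups, the intersection of
the derived subgroup `[G,G]` with the center `Z(G)` is trivial. -/
theorem commutator_inf_center_eq_bot_segmentP (p : ℕ) (hp : p.Prime) (k l κ μ : ℕ)
    (hκ : κ ≤ k) (hμ : μ ≤ l) (hdiff : k - κ = l - μ) :
    commutator (SegmentP p k l κ μ) ⊓ Subgroup.center (SegmentP p k l κ μ) = ⊥ := by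
  rcases eq_or_ne κ 0 with h | hκ0
  · rw [(commutator_eq_bot_iff_center_eq_top _).2 (SegmentP.center_eq_top_of_left_eq_zero h),
      bot_inf_eq]
  rcases eq_or_ne μ 0 with h | hμ0
  · rw [(commutator_eq_bot_iff_center_eq_top _).2 (SegmentP.center_eq_top_of_right_eq_zero h),
      bot_inf_eq]
  exact ((SegmentP.disjoint_commutator_amalgam hκ hμ hdiff).mono_right
    (SegmentP.center_le_amalgam hp hκ hμ hκ0 hμ0)).eq_bot
end

section
/- Let k and l be integers with k ≥ 2 and l ≥ 2, and let G = ⟨a, b | a^k = b^l⟩ be the free product of two infinite cyclic groups amalgamated over ⟨a^k⟩ = ⟨b^l⟩. Then the center of G equals the cyclic subgroup generated by a^k (which equals b^l in G). -/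
namespace Monoid.CoprodI

variable {ι : Type*} {G : ι → Type*} [∀ i, Group (G i)]

theorem NeWord.toList_eq_of_prod_eq {i j i' j' : ι} {w : NeWord G i j} {w' : NeWord G i' j'}
    (h : w.prod = w'.prod) : w.toList = w'.toList := by
  classical
  exact congrArg Word.toList (Word.equiv.symm.injective h : w.toWord = w'.toWord)

/-- An element of a free product commuting with a nontrivial element of every factor is trivial. -/
theorem eq_one_of_forall_exists_commute [Nontrivial ι] {z : CoprodI G}
    (h : ∀ i, ∃ g : G i, g ≠ 1 ∧ Commute (of g) z) : z = 1 := by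
  classical
  by_contra hz
  have hne : Word.equiv z ≠ Word.empty := fun he => hz <| by
    rw [← Word.equiv.symm_apply_apply z, he]
    exact Word.prod_empty
  obtain ⟨i, j, w, hw⟩ := NeWord.of_word _ hne
  obtain rfl : w.prod = z := by
    rw [NeWord.prod, hw]
    exact Word.equiv.symm_apply_apply z
  -- a letter from a factor other than that of the last letter of `w` conjugates to a longer word
  obtain ⟨m, hm⟩ := exists_ne j
  obtain ⟨g, hg, hc⟩ := h m
  have hp : (((w.append hm.symm (.singleton g hg)).append hm w.inv)).prod =
      (NeWord.singleton g hg).prod := by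
    simp [← hc.eq]
  have hlen := congrArg List.length (NeWord.toList_eq_of_prod_eq hp)
  have := List.length_pos_of_ne_nil w.toList_ne_nil
  simp at hlen
  omega

end Monoid.CoprodI

/-- The homomorphism from the cyclic group of order `n` sending the generator to `x`, where
`x ^ n = 1`. -/
def zmodPowersHom {G : Type*} [Group G] (n : ℕ) (x : G) (hx : x ^ n = 1) :
    Multiplicative (ZMod n) →* G :=
  (ZMod.lift n ⟨zmultiplesHom (Additive G) (.ofMul x), by
    simp [← ofMul_pow, hx]⟩).toMultiplicativeLeft

theorem zmodPowersHom_ofAdd_one {G : Type*} [Group G] (n : ℕ) (x : G) (hx : x ^ n = 1) :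
    zmodPowersHom n x hx (.ofAdd 1) = x := by
  have := ZMod.lift_coe n (⟨zmultiplesHom (Additive G) (.ofMul x), by
    simp [← ofMul_pow, hx]⟩ : {f : ℤ →+ Additive G // f n = 0}) 1
  rw [Int.cast_one] at this
  exact (congrArg Additive.toMul this).trans (by simp)

namespace GBS

variable (k l : ℕ)

theorem of_zero_pow_eq_of_one_pow :
    (PresentedGroup.of 0 : GBS k l) ^ k = (PresentedGroup.of 1 : GBS k l) ^ l := by
  have h : PresentedGroup.mk {FreeGroup.of 0 ^ k * (FreeGroup.of 1 ^ l)⁻¹}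
      (FreeGroup.of (0 : Fin 2) ^ k * (FreeGroup.of 1 ^ l)⁻¹) = 1 :=
    PresentedGroup.one_of_mem rfl
  rwa [map_mul, map_inv, map_pow, map_pow, mul_inv_eq_one] at h

theorem of_zero_pow_mem_center :
    (PresentedGroup.of 0 : GBS k l) ^ k ∈ Subgroup.center (GBS k l) := by
  rw [← SetLike.mem_coe, ← Set.singleton_subset_iff, ← Subgroup.centralizer_eq_top_iff_subset,
    eq_top_iff, ← PresentedGroup.closure_range_of, Subgroup.closure_le]
  rintro _ ⟨i, rfl⟩
  rw [SetLike.mem_coe, Subgroup.mem_centralizer_singleton_iff]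
  fin_cases i
  · exact (Commute.self_pow _ k).eq
  · rw [of_zero_pow_eq_of_one_pow]
    exact (Commute.self_pow _ l).eq

/-- The free product of the cyclic groups of orders `k` and `l`. -/
abbrev CyclicCoprod : Type :=
  Monoid.CoprodI fun i : Fin 2 => Multiplicative (ZMod (![k, l] i))

/-- The projection of `⟨a, b | a^k = b^l⟩` onto `⟨a, b | a^k = b^l = 1⟩`. -/
def toCyclicCoprod : GBS k l →* CyclicCoprod k l :=
  PresentedGroup.toGroup (f := fun i => Monoid.CoprodI.of (i := i) (.ofAdd 1)) <| by
    have h (i : Fin 2) : (Monoid.CoprodI.of (i := i) (.ofAdd 1) : CyclicCoprod k l) ^ ![k, l] i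
        = 1 := by
      rw [← map_pow, ← ofAdd_nsmul, nsmul_one, ZMod.natCast_self, ofAdd_zero, map_one]
    rintro _ rfl
    simpa [mul_inv_eq_one] using (h 0).trans (h 1).symm

theorem toCyclicCoprod_of (i : Fin 2) :
    toCyclicCoprod k l (PresentedGroup.of i) = Monoid.CoprodI.of (i := i) (.ofAdd 1) :=
  PresentedGroup.toGroup.of _

theorem ker_toCyclicCoprod_le :
    (toCyclicCoprod k l).ker ≤ Subgroup.zpowers ((PresentedGroup.of 0 : GBS k l) ^ k) := by
  set N := Subgroup.zpowers ((PresentedGroup.of 0 : GBS k l) ^ k) with hN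
  have hle : N ≤ Subgroup.center (GBS k l) :=
    Subgroup.zpowers_le.2 (of_zero_pow_mem_center k l)
  have : N.Normal := ⟨fun n hn g => by
    rwa [Subgroup.mem_center_iff.1 (hle hn) g, mul_inv_cancel_right]⟩
  have hpow (i : Fin 2) : QuotientGroup.mk' N (PresentedGroup.of i) ^ ![k, l] i = 1 := by
    rw [← map_pow, QuotientGroup.mk'_apply, QuotientGroup.eq_one_iff]
    fin_cases i
    · exact Subgroup.mem_zpowers _
    · rw [hN, of_zero_pow_eq_of_one_pow]
      exact Subgroup.mem_zpowers _
  let ψ : CyclicCoprod k l →* GBS k l ⧸ N :=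
    Monoid.CoprodI.lift fun i => zmodPowersHom _ _ (hpow i)
  have hψ : ψ.comp (toCyclicCoprod k l) = QuotientGroup.mk' N := by
    refine PresentedGroup.ext fun i => ?_
    rw [MonoidHom.comp_apply, toCyclicCoprod_of, Monoid.CoprodI.lift_of, zmodPowersHom_ofAdd_one]
  rw [← QuotientGroup.ker_mk' N, ← hψ]
  exact fun x hx => by rw [MonoidHom.mem_ker, MonoidHom.comp_apply, hx, map_one]

end GBS


/-- For `G = ⟨a, b | a^k = b^l⟩` with `k, l ≥ 2`, the center of `G` is the cyclic subgroup
generated by `a^k` (which equals `b^l` in `G`). -/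
theorem center_GBS (k l : ℕ) (hk : 2 ≤ k) (hl : 2 ≤ l) :
    Subgroup.center (GBS k l) =
      Subgroup.zpowers ((PresentedGroup.of 0 : GBS k l) ^ k) := by
  refine le_antisymm (fun z hz => GBS.ker_toCyclicCoprod_le k l ?_)
    (Subgroup.zpowers_le.2 (GBS.of_zero_pow_mem_center k l))
  refine Monoid.CoprodI.eq_one_of_forall_exists_commute fun i => ⟨.ofAdd 1, ?_, ?_⟩
  · have : Fact (1 < ![k, l] i) := ⟨by fin_cases i <;> assumption⟩
    exact fun h => one_ne_zero (ofAdd_eq_one.1 h)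
  · rw [← GBS.toCyclicCoprod_of]
    exact Commute.map (Subgroup.mem_center_iff.1 hz _) _
end

section
/- Let p be a prime and κ, λ natural numbers, and let G = ⟨a, b | a^{p^κ} = b^{p^λ}⟩ be the free product of two infinite cyclic groups amalgamated over ⟨a^{p^κ}⟩ = ⟨b^{p^λ}⟩. Then G is residually a finite p-group: for every g ≠ 1 in G there is a homomorphism φ from G to a finite p-group with φ(g) ≠ 1. -/
/-- `G` is residually a finite `p`-group: for every `g ≠ 1` in `G` there is a homomorphism `φ`
from `G` to a finite `p`-group with `φ(g) ≠ 1`. -/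
def IsResiduallyFinitePGroup (p : ℕ) (G : Type*) [Group G] : Prop :=
  ∀ g : G, g ≠ 1 →
    ∃ (H : Type) (_ : Group H) (_ : Fintype H), IsPGroup p H ∧ ∃ φ : G →* H, φ g ≠ 1

section OneAdd

variable {R : Type*} [Ring R] (p : ℕ) [Fact p.Prime] [CharP R p]

/-- In a ring of characteristic `p`, the units congruent to `1` modulo a non-unital subring of
bounded nilpotency index form a subgroup. -/
def oneAddSubgroup (S : NonUnitalSubring R) (k : ℕ) (hS : ∀ x ∈ S, x ^ p ^ k = 0) :
    Subgroup Rˣ where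
  carrier := {u | (u : R) - 1 ∈ S}
  one_mem' := by simp
  mul_mem' {u v} hu hv := by
    have h := S.add_mem (S.add_mem (S.mul_mem hu hv) hu) hv
    have e : ((u * v : Rˣ) : R) - 1 = (u - 1) * (v - 1) + (u - 1) + (v - 1) := by
      push_cast; noncomm_ring
    simpa only [Set.mem_ofPred_eq, e] using h
  inv_mem' {u} hu := by
    have hpow : ∀ n : ℕ, ((u ^ n : Rˣ) : R) - 1 ∈ S := by
      intro n
      induction n with
      | zero => simp
      | succ n ih =>
        have h := S.add_mem (S.add_mem (S.mul_mem ih hu) ih) hu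
        have e : ((u ^ (n + 1) : Rˣ) : R) - 1
            = ((u ^ n : Rˣ) - 1) * (u - 1) + ((u ^ n : Rˣ) - 1) + (u - 1) := by
          rw [pow_succ, Units.val_mul]; noncomm_ring
        simpa only [e] using h
    have h1 : u ^ p ^ k = 1 := by
      ext
      have h := hS _ hu
      rw [sub_pow_char_pow_of_commute p k (Commute.one_right _), one_pow, sub_eq_zero] at h
      simpa using h
    have hinv : u⁻¹ = u ^ (p ^ k - 1) := by
      rw [inv_eq_iff_mul_eq_one, ← pow_succ',
        Nat.sub_add_cancel (Nat.one_le_pow _ _ (Fact.out : p.Prime).pos), h1]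
    simpa only [Set.mem_ofPred_eq, hinv] using hpow _

theorem isPGroup_oneAddSubgroup (S : NonUnitalSubring R) (k : ℕ)
    (hS : ∀ x ∈ S, x ^ p ^ k = 0) : IsPGroup p (oneAddSubgroup p S k hS) := by
  rintro ⟨u, hu⟩
  refine ⟨k, ?_⟩
  ext
  have h := hS _ hu
  rw [sub_pow_char_pow_of_commute p k (Commute.one_right _), one_pow, sub_eq_zero] at h
  simpa using h

end OneAdd

section WordMatrix

variable {α : Type*} [DecidableEq α] (p : ℕ) (M : List α)

/-- The finite set of suffixes of a word. -/
abbrev Suffixes : Type _ := {w : List α // w <:+ M}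

instance : Finite (Suffixes M) :=
  Finite.of_injective (fun w : Suffixes M => (⟨w.1, (List.mem_tails _ _).2 w.2⟩ :
    {w // w ∈ M.tails})) fun a b h => Subtype.ext (by simpa using h)

noncomputable instance : Fintype (Suffixes M) := Fintype.ofFinite _

/-- The action of a word by deletion of prefixes on the suffixes of `M`. -/
def wordMatrix (v : List α) : Matrix (Suffixes M) (Suffixes M) (ZMod p) :=
  Matrix.of fun w w' => if w.1 = v ++ w'.1 then 1 else 0

theorem wordMatrix_nil : wordMatrix p M [] = 1 := by
  ext w w'
  simp [wordMatrix, Matrix.one_apply, Subtype.ext_iff]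

theorem wordMatrix_mul_apply_append (v x : List α) (h : v ++ x <:+ M)
    (Q : Matrix (Suffixes M) (Suffixes M) (ZMod p)) (w' : Suffixes M) :
    (wordMatrix p M v * Q) ⟨v ++ x, h⟩ w' = Q ⟨x, (List.suffix_append v x).trans h⟩ w' := by
  rw [Matrix.mul_apply, Finset.sum_eq_single ⟨x, (List.suffix_append v x).trans h⟩]
  · simp [wordMatrix]
  · intro b _ hb
    have : x ≠ b.1 := fun h => hb (Subtype.ext h.symm)
    simp [wordMatrix, this]
  · simp

theorem wordMatrix_mul_apply_of_not_prefix (v : List α) (w : Suffixes M) (h : ¬ v <+: w.1)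
    (Q : Matrix (Suffixes M) (Suffixes M) (ZMod p)) (w' : Suffixes M) :
    (wordMatrix p M v * Q) w w' = 0 := by
  rw [Matrix.mul_apply]
  refine Finset.sum_eq_zero fun b _ => ?_
  have : w.1 ≠ v ++ b.1 := fun e => h ⟨_, e.symm⟩
  simp [wordMatrix, this]

theorem wordMatrix_mul (u v : List α) :
    wordMatrix p M u * wordMatrix p M v = wordMatrix p M (u ++ v) := by
  ext ⟨w, hw⟩ w'
  by_cases h : u <+: w
  · obtain ⟨x, rfl⟩ := h
    rw [wordMatrix_mul_apply_append]
    simp [wordMatrix]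
  · rw [wordMatrix_mul_apply_of_not_prefix _ _ _ _ h]
    have : w ≠ u ++ (v ++ w'.1) := fun e => h ⟨_, e.symm⟩
    simp [wordMatrix, this]

theorem wordMatrix_replicate_pow (q n : ℕ) (i : α) :
    wordMatrix p M (List.replicate q i) ^ n = wordMatrix p M (List.replicate (q * n) i) := by
  induction n with
  | zero => simp [wordMatrix_nil]
  | succ n ih => rw [pow_succ, ih, wordMatrix_mul, ← List.replicate_add, Nat.mul_succ]

theorem wordMatrix_eq_zero (v : List α) (h : ¬ v <:+: M) : wordMatrix p M v = 0 := by
  ext w w'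
  have : w.1 ≠ v ++ w'.1 := fun e =>
    h ((List.prefix_append v w'.1).isInfix.trans (e ▸ w.2.isInfix))
  simp [wordMatrix, this]

/-- Matrices strictly decreasing the length of words. -/
def strictlyDecreasing : NonUnitalSubring (Matrix (Suffixes M) (Suffixes M) (ZMod p)) where
  carrier := {A | ∀ w w', w.1.length ≤ w'.1.length → A w w' = 0}
  add_mem' {A B} hA hB w w' h := by simp [hA w w' h, hB w w' h]
  zero_mem' _ _ _ := rfl
  neg_mem' {A} hA w w' h := by simp [hA w w' h]
  mul_mem' {A B} hA hB w w' h := by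
    rw [Matrix.mul_apply]
    refine Finset.sum_eq_zero fun x _ => ?_
    rcases le_total w.1.length x.1.length with hx | hx
    · simp [hA w x hx]
    · simp [hB x w' (hx.trans h)]

theorem pow_eq_zero_of_mem_strictlyDecreasing {A : Matrix (Suffixes M) (Suffixes M) (ZMod p)}
    (hA : A ∈ strictlyDecreasing p M) {n : ℕ} (hn : M.length < n) : A ^ n = 0 := by
  have key : ∀ n : ℕ, ∀ w w' : Suffixes M, w.1.length < w'.1.length + n → (A ^ n) w w' = 0 := by
    intro n
    induction n with
    | zero =>
      intro w w' h
      rw [pow_zero, Matrix.one_apply_ne]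
      rintro rfl
      omega
    | succ n ih =>
      intro w w' h
      rw [pow_succ, Matrix.mul_apply]
      refine Finset.sum_eq_zero fun x _ => ?_
      by_cases hx : w.1.length < x.1.length + n
      · simp [ih w x hx]
      · simp [hA x w' (by omega)]
  ext w w'
  exact key n w w' (by have := w.2.length_le; omega)

theorem wordMatrix_mem_strictlyDecreasing {v : List α} (hv : v ≠ []) :
    wordMatrix p M v ∈ strictlyDecreasing p M := by
  intro w w' h
  have : w.1 ≠ v ++ w'.1 := by
    intro e
    have := congrArg List.length e
    have := List.length_pos_iff.2 hv
    simp at *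
    omega
  simp [wordMatrix, this]

instance : Nonempty (Suffixes M) := ⟨⟨[], List.nil_suffix⟩⟩

theorem one_add_wordMatrix_pow [Fact p.Prime] (i : α) (s u : ℕ) :
    (1 + wordMatrix p M [i]) ^ (p ^ s * u) =
      ∑ n ∈ Finset.range (u + 1),
        u.choose n • wordMatrix p M (List.replicate (p ^ s * n) i) := by
  have h1 := wordMatrix_replicate_pow p M 1 (p ^ s) i
  rw [List.replicate_one, one_mul] at h1
  rw [pow_mul, add_pow_char_pow_of_commute p s (Commute.one_left _), one_pow, h1, add_comm,
    (Commute.one_right _).add_pow]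
  refine Finset.sum_congr rfl fun n _ => ?_
  rw [wordMatrix_replicate_pow, one_pow, mul_one, nsmul_eq_mul, Nat.cast_comm]

end WordMatrix

section Syllables

variable {α : Type*} (p : ℕ)

/-- The word whose coefficient detects a product of syllables: the syllable `(i, s, u)`, which
stands for `x_i ^ (p ^ s * u)`, contributes a run of `p ^ s` letters `i`. -/
def leadingWord (l : List (α × ℕ × ℕ)) : List α :=
  l.flatMap fun x => List.replicate (p ^ x.2.1) x.1

/-- A list of syllables `(i, s, u)` is reduced with respect to `e` if adjacent syllables have
different letters, and for each of them `s < e i` and `u` is prime to `p`. -/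
def IsReducedList (e : α → ℕ) (l : List (α × ℕ × ℕ)) : Prop :=
  l.IsChain (fun x y => x.1 ≠ y.1) ∧ ∀ x ∈ l, x.2.1 < e x.1 ∧ ¬ p ∣ x.2.2

variable {p}

theorem leadingWord_cons (i : α) (s u : ℕ) (t : List (α × ℕ × ℕ)) :
    leadingWord p ((i, s, u) :: t) = List.replicate (p ^ s) i ++ leadingWord p t := rfl

theorem IsReducedList.tail {e : α → ℕ} {x : α × ℕ × ℕ} {t : List (α × ℕ × ℕ)}
    (h : IsReducedList p e (x :: t)) : IsReducedList p e t :=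
  ⟨(List.isChain_cons.1 h.1).2, fun y hy => h.2 y (List.mem_cons_of_mem _ hy)⟩

theorem leadingWord_ne_cons (hp : 0 < p) {t : List (α × ℕ × ℕ)} {i : α}
    (h : ∀ y ∈ t.head?, i ≠ y.1) (w : List α) : leadingWord p t ≠ i :: w := by
  rcases t with _ | ⟨⟨j, s, u⟩, t⟩
  · simp [leadingWord]
  · rw [leadingWord_cons]
    obtain ⟨q, hq⟩ := Nat.exists_eq_succ_of_ne_zero (pow_pos hp s).ne'
    rw [hq, List.replicate_succ, List.cons_append]
    intro e
    exact h _ rfl (List.cons.inj e).1.symm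

theorem replicate_not_infix_leadingWord (hp1 : 1 < p) {e : α → ℕ} (i : α)
    {l : List (α × ℕ × ℕ)} (h : IsReducedList p e l) :
    ¬ List.replicate (p ^ e i) i <:+: leadingWord p l := by
  have hp : 0 < p := by omega
  induction l with
  | nil => simp [leadingWord, hp.ne']
  | cons x t ih =>
    obtain ⟨k, s, u⟩ := x
    have hs : s < e k := (h.2 _ List.mem_cons_self).1
    have hk := (List.isChain_cons.1 h.1).1
    have key : ∀ q ≤ p ^ s,
        ¬ List.replicate (p ^ e i) i <:+: List.replicate q k ++ leadingWord p t := by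
      intro q
      induction q with
      | zero => simpa using ih h.tail
      | succ q ihq =>
        intro hq hinf
        rw [List.replicate_succ, List.cons_append, List.infix_cons_iff] at hinf
        rcases hinf with hpre | hinf
        · obtain ⟨m, hm⟩ := Nat.exists_eq_succ_of_ne_zero (pow_pos hp (e i)).ne'
          have hik : i = k := by
            rw [hm, List.replicate_succ] at hpre
            exact (List.cons_prefix_cons.1 hpre).1
          subst hik
          have hlt : p ^ s < p ^ e i := Nat.pow_lt_pow_right hp1 hs
          obtain ⟨r, hr⟩ : ∃ r, p ^ e i = (q + 1) + (r + 1) :=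
            ⟨p ^ e i - (q + 1) - 1, by omega⟩
          rw [hr, List.replicate_add, ← List.cons_append, ← List.replicate_succ,
            List.prefix_append_right_inj, List.replicate_succ] at hpre
          obtain ⟨w, hw⟩ := hpre
          exact leadingWord_ne_cons hp hk _ hw.symm
        · exact ihq (by omega) hinf
    rw [leadingWord_cons]
    exact key _ le_rfl

variable [DecidableEq α] (p) (M : List α)

/-- The image of a product of syllables under `x_i ↦ 1 + wordMatrix p M [i]`. -/
noncomputable def syllableMatrix (l : List (α × ℕ × ℕ)) : Matrix (Suffixes M) (Suffixes M) (ZMod p) :=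
  (l.map fun x => (1 + wordMatrix p M [x.1]) ^ (p ^ x.2.1 * x.2.2)).prod

theorem syllableMatrix_cons_apply [Fact p.Prime] (i : α) (s u : ℕ) (t : List (α × ℕ × ℕ))
    (w w' : Suffixes M) :
    syllableMatrix p M ((i, s, u) :: t) w w' =
      ∑ n ∈ Finset.range (u + 1), u.choose n •
        (wordMatrix p M (List.replicate (p ^ s * n) i) * syllableMatrix p M t) w w' := by
  rw [syllableMatrix, List.map_cons, List.prod_cons, one_add_wordMatrix_pow, Finset.sum_mul,
    Matrix.sum_apply]
  simp only [smul_mul_assoc, Matrix.smul_apply]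
  rfl

theorem syllableMatrix_apply_eq_zero [Fact p.Prime] {l : List (α × ℕ × ℕ)} {j : α}
    (hl : l.IsChain fun x y => x.1 ≠ y.1) (hj : ∀ y ∈ l.head?, j ≠ y.1) (x : List α)
    (h : x ++ j :: leadingWord p l <:+ M) :
    syllableMatrix p M l ⟨x ++ j :: leadingWord p l, h⟩ ⟨[], List.nil_suffix⟩ = 0 := by
  have hp := (Fact.out : p.Prime).pos
  induction l generalizing j x with
  | nil =>
    rw [syllableMatrix, List.map_nil, List.prod_nil, Matrix.one_apply_ne]
    simp
  | cons y t ih =>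
    obtain ⟨i, s, u⟩ := y
    rw [syllableMatrix_cons_apply]
    refine Finset.sum_eq_zero fun n _ => ?_
    by_cases hpre : List.replicate (p ^ s * n) i <+: x ++ j :: leadingWord p ((i, s, u) :: t)
    · obtain ⟨z, hz⟩ := hpre
      obtain ⟨q, hq⟩ := Nat.exists_eq_succ_of_ne_zero (pow_pos hp s).ne'
      obtain ⟨x', rfl⟩ : ∃ x', z = x' ++ j :: leadingWord p ((i, s, u) :: t) := by
        rcases List.append_eq_append_iff.1 hz with ⟨as, -, h2⟩ | ⟨bs, h1, h2⟩
        · exact ⟨as, h2⟩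
        · rcases bs with _ | ⟨b, bs⟩
          · exact ⟨[], by simpa using h2.symm⟩
          · rw [List.cons_append] at h2
            have hb : b ∈ List.replicate (p ^ s * n) i := by simp [h1]
            exact absurd ((List.cons.inj h2).1.trans (List.eq_of_mem_replicate hb)) (hj _ rfl)
      have hz' : x' ++ j :: leadingWord p ((i, s, u) :: t) =
          (x' ++ j :: List.replicate q i) ++ i :: leadingWord p t := by
        rw [leadingWord_cons, hq, List.replicate_succ']
        simp
      have h0 := wordMatrix_mul_apply_append p M _ _ (hz ▸ h) (syllableMatrix p M t)
        ⟨[], List.nil_suffix⟩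
      simp only [hz] at h0
      rw [h0]
      simp only [hz']
      rw [ih (List.isChain_cons.1 hl).2 (List.isChain_cons.1 hl).1, smul_zero]
    · rw [wordMatrix_mul_apply_of_not_prefix _ _ _ _ hpre, smul_zero]

theorem syllableMatrix_apply_leadingWord [Fact p.Prime] {l : List (α × ℕ × ℕ)}
    (hl : l.IsChain fun x y => x.1 ≠ y.1) (hu : ∀ x ∈ l, ¬ p ∣ x.2.2)
    (h : leadingWord p l <:+ M) :
    syllableMatrix p M l ⟨leadingWord p l, h⟩ ⟨[], List.nil_suffix⟩ ≠ 0 := by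
  have hp := (Fact.out : p.Prime).pos
  induction l with
  | nil => simp [syllableMatrix, leadingWord]
  | cons y t ih =>
    obtain ⟨i, s, u⟩ := y
    have hi := (List.isChain_cons.1 hl).1
    have hpu : ¬ p ∣ u := hu _ List.mem_cons_self
    obtain ⟨q, hq⟩ := Nat.exists_eq_succ_of_ne_zero (pow_pos hp s).ne'
    have hu0 : u ≠ 0 := fun h => hpu (h ▸ dvd_zero p)
    rw [syllableMatrix_cons_apply, Finset.sum_eq_single 1]
    · have h0 := wordMatrix_mul_apply_append p M (List.replicate (p ^ s) i) (leadingWord p t) h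
        (syllableMatrix p M t) ⟨[], List.nil_suffix⟩
      simp only [leadingWord_cons, mul_one, Nat.choose_one_right]
      rw [h0, nsmul_eq_mul]
      exact mul_ne_zero (mt (ZMod.natCast_eq_zero_iff _ _).1 hpu)
        (ih (List.isChain_cons.1 hl).2 (fun x hx => hu x (List.mem_cons_of_mem _ hx)) _)
    · intro n _ hn
      rcases n with _ | _ | n
      · have hz : leadingWord p ((i, s, u) :: t) =
            List.replicate q i ++ i :: leadingWord p t := by
          rw [leadingWord_cons, hq, List.replicate_succ']
          simp
        rw [mul_zero, List.replicate_zero, wordMatrix_nil, one_mul]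
        simp only [hz]
        rw [syllableMatrix_apply_eq_zero p M (List.isChain_cons.1 hl).2 hi, smul_zero]
      · exact absurd rfl hn
      · rw [wordMatrix_mul_apply_of_not_prefix, smul_zero]
        change ¬ _ <+: leadingWord p ((i, s, u) :: t)
        rw [leadingWord_cons, show p ^ s * (n + 1 + 1) = p ^ s + (p ^ s * n + q + 1) by
          rw [mul_add, mul_add, mul_one, hq]; omega, List.replicate_add,
          List.prefix_append_right_inj, List.replicate_succ]
        rintro ⟨w, hw⟩
        exact leadingWord_ne_cons hp hi _ hw.symm
    · intro hn
      exact absurd (Finset.mem_range.2 (by omega)) hn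

/-- A nonempty reduced product of syllables is nontrivial in some finite `p`-group in which the
`i`-th generator has order dividing `p ^ e i`. -/
theorem exists_isPGroup_syllable_prod_ne_one {α : Type} [Fact p.Prime] {e : α → ℕ}
    {l : List (α × ℕ × ℕ)} (hl : IsReducedList p e l) (hne : l ≠ []) :
    ∃ (H : Type) (_ : Group H) (_ : Fintype H), IsPGroup p H ∧ ∃ f : α → H,
      (∀ i, f i ^ p ^ e i = 1) ∧ (l.map fun x => f x.1 ^ (p ^ x.2.1 * x.2.2)).prod ≠ 1 := by
  classical
  have hp := (Fact.out : p.Prime)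
  set M := leadingWord p l with hM
  have hk := fun A (hA : A ∈ strictlyDecreasing p M) =>
    pow_eq_zero_of_mem_strictlyDecreasing p M hA (Nat.lt_pow_self hp.one_lt (n := M.length))
  have hord : ∀ i, (1 + wordMatrix p M [i]) ^ p ^ e i = 1 := by
    intro i
    have h1 := wordMatrix_replicate_pow p M 1 (p ^ e i) i
    rw [List.replicate_one, one_mul] at h1
    rw [add_pow_char_pow_of_commute p _ (Commute.one_left _), one_pow, h1,
      wordMatrix_eq_zero _ _ _ (replicate_not_infix_leadingWord hp.one_lt i hl), add_zero]
  let f : α → oneAddSubgroup p (strictlyDecreasing p M) M.length hk := fun i =>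
    ⟨Units.ofPowEqOne _ _ (hord i) (pow_pos hp.pos _).ne',
      show 1 + wordMatrix p M [i] - 1 ∈ _ by
        rw [add_sub_cancel_left]
        exact wordMatrix_mem_strictlyDecreasing p M (List.cons_ne_nil _ _)⟩
  have hf : ∀ i, ((f i : (Matrix (Suffixes M) (Suffixes M) (ZMod p))ˣ) :
      Matrix (Suffixes M) (Suffixes M) (ZMod p)) = 1 + wordMatrix p M [i] := fun _ => rfl
  refine ⟨oneAddSubgroup p (strictlyDecreasing p M) M.length hk, inferInstance,
    Fintype.ofFinite _, isPGroup_oneAddSubgroup _ _ _ _, f, fun i => ?_, fun hprod => ?_⟩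
  · ext1
    ext1
    push_cast
    rw [hf, hord]
  · have h1 : syllableMatrix p M l = 1 := by
      have := congrArg ((Units.coeHom _).comp (Subgroup.subtype _)) hprod
      rw [map_list_prod, map_one, List.map_map] at this
      exact this
    refine syllableMatrix_apply_leadingWord p M hl.1 (fun x hx => (hl.2 x hx).2)
      (List.suffix_refl _) ?_
    rw [h1, Matrix.one_apply_ne]
    obtain ⟨⟨i, s, u⟩, t, rfl⟩ := List.exists_cons_of_ne_nil hne
    simp [leadingWord_cons, hp.ne_zero]

theorem exists_reduced_prod {G : Type*} [Group G] {α : Type*} {p : ℕ} (hp : p.Prime) {e : α → ℕ}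
    {f : α → G} {c : G} (hc : ∀ i, f i ^ p ^ e i = c)
    (hf : Subgroup.closure (Set.range f) = ⊤) (g : G) :
    ∃ (k : ℤ) (l : List (α × ℕ × ℕ)), IsReducedList p e l ∧
      g = c ^ k * (l.map fun x => f x.1 ^ (p ^ x.2.1 * x.2.2)).prod := by
  classical
  have hcomm : ∀ i (z k : ℤ), f i ^ z * c ^ k = c ^ k * f i ^ z := by
    intro i z k
    rw [← hc i]
    exact (((Commute.refl (f i)).pow_right _).zpow_zpow z k)
  have hcons : ∀ i (z k : ℤ) (t : List (α × ℕ × ℕ)), IsReducedList p e t →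
      (∀ y ∈ t.head?, i ≠ y.1) → ∃ (k' : ℤ) (l : List (α × ℕ × ℕ)), IsReducedList p e l ∧
        f i ^ z * (c ^ k * (t.map fun x => f x.1 ^ (p ^ x.2.1 * x.2.2)).prod) =
          c ^ k' * (l.map fun x => f x.1 ^ (p ^ x.2.1 * x.2.2)).prod := by
    intro i z k t ht hi
    have hm : (0 : ℤ) < (p ^ e i : ℕ) := by exact_mod_cast pow_pos hp.pos _
    obtain ⟨r, hr⟩ := Int.eq_ofNat_of_zero_le (Int.emod_nonneg z hm.ne')
    have hrlt : r < p ^ e i := by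
      have := Int.emod_lt_of_pos z hm
      rw [hr] at this
      exact_mod_cast this
    have hz : f i ^ z = c ^ (z / (p ^ e i : ℕ)) * f i ^ r := by
      conv_lhs => rw [← Int.mul_ediv_add_emod z (p ^ e i : ℕ), hr, zpow_add, zpow_mul]
      rw [zpow_natCast, hc]
      simp
    have hcr : f i ^ r * c ^ k = c ^ k * f i ^ r := by simpa using hcomm i r k
    rw [← mul_assoc, hz, mul_assoc (c ^ _), hcr, ← mul_assoc, ← zpow_add, mul_assoc]
    rcases eq_or_ne r 0 with rfl | hr0
    · exact ⟨_, t, ht, by rw [pow_zero, one_mul]⟩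
    · obtain ⟨s, u, hu, rfl⟩ := Nat.exists_eq_pow_mul_and_not_dvd hr0 p hp.ne_one
      refine ⟨_, (i, s, u) :: t, ⟨List.isChain_cons.2 ⟨hi, ht.1⟩, ?_⟩, by
        rw [List.map_cons, List.prod_cons]⟩
      rintro x hx
      rcases List.mem_cons.1 hx with rfl | hx
      · refine ⟨(Nat.pow_lt_pow_iff_right hp.one_lt).1 (lt_of_le_of_lt ?_ hrlt), hu⟩
        exact Nat.le_mul_of_pos_right _ (Nat.pos_of_ne_zero (right_ne_zero_of_mul hr0))
      · exact ht.2 x hx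
  have hstep : ∀ i (z : ℤ) (y : G), (∃ (k : ℤ) (l : List (α × ℕ × ℕ)), IsReducedList p e l ∧
      y = c ^ k * (l.map fun x => f x.1 ^ (p ^ x.2.1 * x.2.2)).prod) →
      ∃ (k : ℤ) (l : List (α × ℕ × ℕ)), IsReducedList p e l ∧
        f i ^ z * y = c ^ k * (l.map fun x => f x.1 ^ (p ^ x.2.1 * x.2.2)).prod := by
    rintro i z _ ⟨k, l, hl, rfl⟩
    by_cases h : ∀ y ∈ l.head?, i ≠ y.1
    · exact hcons i z k l hl h
    · rcases l with _ | ⟨⟨j, s, u⟩, t⟩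
      · simp at h
      · obtain rfl : i = j := by simpa using h
        obtain ⟨k', l, hl', he⟩ := hcons i (z + (p ^ s * u : ℕ)) k t hl.tail
          (List.isChain_cons.1 hl.1).1
        refine ⟨k', l, hl', ?_⟩
        rw [← he, List.map_cons, List.prod_cons, zpow_add, mul_assoc, zpow_natCast,
          ← mul_assoc (c ^ k), ← mul_assoc (f i ^ (p ^ s * u))]
        congr 2
        rw [← zpow_natCast, hcomm]
  have hg : g ∈ Subgroup.closure (Set.range f) := hf ▸ Subgroup.mem_top g
  induction hg using Subgroup.closure_induction_left with
  | one => exact ⟨0, [], ⟨List.isChain_nil, by simp⟩, by simp⟩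
  | mul_left x hx y _ ih =>
    obtain ⟨i, rfl⟩ := hx
    simpa using hstep i 1 y ih
  | inv_mul_cancel x hx y _ ih =>
    obtain ⟨i, rfl⟩ := hx
    simpa using hstep i (-1) y ih

end Syllables

/-- A homomorphism out of `GBS k l` from a solution of `x ^ k = y ^ l`. -/
theorem GBS.exists_hom {k l : ℕ} {H : Type*} [Group H] (f : Fin 2 → H) (h : f 0 ^ k = f 1 ^ l) :
    ∃ φ : GBS k l →* H, ∀ i, φ (PresentedGroup.of i) = f i :=
  ⟨PresentedGroup.toGroup (f := f) (by simp [h]), fun _ => PresentedGroup.toGroup.of _⟩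

theorem GBS.relation (k l : ℕ) :
    (PresentedGroup.of 0 : GBS k l) ^ k = (PresentedGroup.of 1 : GBS k l) ^ l := by
  have h := PresentedGroup.one_of_mem
    (Set.mem_singleton (FreeGroup.of (0 : Fin 2) ^ k * (FreeGroup.of 1 ^ l)⁻¹))
  rwa [map_mul, map_inv, map_pow, map_pow, mul_inv_eq_one] at h

/-- For a prime `p` and natural numbers `κ, λ`, the group `G = ⟨a, b | a^{p^κ} = b^{p^λ}⟩`
is residually a finite `p`-group. -/
theorem GBS_prime_powers_residuallyP (p : ℕ) (hp : p.Prime) (κ μ : ℕ) :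
    IsResiduallyFinitePGroup p (GBS (p ^ κ) (p ^ μ)) := by
  intro g hg
  have : Fact p.Prime := ⟨hp⟩
  have hc : ∀ i : Fin 2, (PresentedGroup.of i : GBS (p ^ κ) (p ^ μ)) ^ p ^ (![κ, μ] i) =
      PresentedGroup.of 0 ^ p ^ κ :=
    Fin.forall_fin_two.2 ⟨rfl, (GBS.relation _ _).symm⟩
  obtain ⟨k, l, hl, rfl⟩ :=
    exists_reduced_prod hp hc (PresentedGroup.closure_range_of _) g
  rcases eq_or_ne l [] with rfl | hne
  · have hk : k ≠ 0 := by
      rintro rfl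
      simp at hg
    have hn : k * p ^ κ * p ^ μ ≠ 0 := by
      have : (p : ℤ) ≠ 0 := by exact_mod_cast hp.ne_zero
      positivity
    set N := (k * p ^ κ * p ^ μ).natAbs with hN
    have : NeZero (p ^ N) := ⟨(pow_pos hp.pos _).ne'⟩
    obtain ⟨φ, hφ⟩ := GBS.exists_hom (k := p ^ κ) (l := p ^ μ)
      (fun i => Multiplicative.ofAdd (![(p ^ μ : ZMod (p ^ N)), p ^ κ] i))
      (by simp [← ofAdd_nsmul, mul_comm])
    refine ⟨Multiplicative (ZMod (p ^ N)), inferInstance, inferInstance,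
      IsPGroup.of_card (n := N) (by simp), φ, ?_⟩
    rw [List.map_nil, List.prod_nil, mul_one, map_zpow, map_pow, hφ, ← ofAdd_nsmul, ← ofAdd_zsmul,
      Ne, ofAdd_eq_one]
    intro h
    have h' : ((k * p ^ κ * p ^ μ : ℤ) : ZMod (p ^ N)) = 0 := by
      simpa [mul_assoc] using h
    rw [ZMod.intCast_zmod_eq_zero_iff_dvd] at h'
    have h2 : p ^ N ∣ N := by
      rw [hN, ← Int.natCast_dvd]
      exact h'
    exact absurd (Nat.le_of_dvd (Int.natAbs_pos.2 hn) h2) (Nat.lt_pow_self hp.one_lt).not_ge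
  · obtain ⟨H, _, _, hH, f, hf, hne⟩ := exists_isPGroup_syllable_prod_ne_one p hl hne
    obtain ⟨φ, hφ⟩ := GBS.exists_hom (k := p ^ κ) (l := p ^ μ) f
      ((hf 0).trans (hf 1).symm)
    refine ⟨H, inferInstance, inferInstance, hH, φ, ?_⟩
    have h0 : f 0 ^ p ^ κ = 1 := hf 0
    rw [map_mul, map_zpow, map_pow, hφ, h0, one_zpow, one_mul, map_list_prod, List.map_map]
    simpa [Function.comp_def, hφ] using hne
end

section
/- Let p be a prime and let k = p^κ·k₁ and l = p^λ·l₁ be positive integers with p not dividing k₁ and p not dividing l₁, and set d₁ = gcd(k₁, l₁). Let G = ⟨a, b | a^k = b^l⟩ be the free product of two infinite cyclic groups amalgamated over ⟨a^k⟩ = ⟨b^l⟩. Then (N_p)_ω(G), the intersection of all normal subgroups of G of finite index a power of p, equals the normal closure in G of the set {a^{k/d₁}·b^{-l/d₁}, [a, b^{p^λ}], [a^{p^κ}, b]}. -/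
/-- `(N_p)_ω(G)`: the intersection of all normal subgroups of `G` whose index is finite and
equal to a power of the prime `p`. -/
def NpOmega (p : ℕ) (G : Type*) [Group G] : Subgroup G :=
  ⨅ N ∈ {N : Subgroup G | N.Normal ∧ ∃ n : ℕ, N.index = p ^ n}, N

/-- The generator `a` of `⟨a, b | a^k = b^l⟩`. -/
abbrev genA (k l : ℕ) : GBS k l := PresentedGroup.of 0

/-- The generator `b` of `⟨a, b | a^k = b^l⟩`. -/
abbrev genB (k l : ℕ) : GBS k l := PresentedGroup.of 1

section ReducedWords

variable {α : Type*}

/-- The product `x c₁ ^ e₁ * x c₂ ^ e₂ * ⋯` of the syllables of a word. -/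
def evalWord {M : Type*} [Monoid M] (x : α → M) (w : List (α × ℕ)) : M :=
  (w.map fun u => x u.1 ^ u.2).prod

theorem map_evalWord {M N : Type*} [Monoid M] [Monoid N] (f : M →* N) (x : α → M)
    (w : List (α × ℕ)) : f (evalWord x w) = evalWord (fun c => f (x c)) w := by
  simp [evalWord, map_list_prod, Function.comp_def]

/-- A word is reduced if consecutive syllables have different letters and no exponent is divisible
by the order `P c` prescribed for its letter `c`. -/
def IsReducedWord (P : α → ℕ) (w : List (α × ℕ)) : Prop :=
  w.IsChain (fun u v => u.1 ≠ v.1) ∧ ∀ u ∈ w, ¬ P u.1 ∣ u.2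

theorem IsReducedWord.tail {P : α → ℕ} {u : α × ℕ} {w : List (α × ℕ)}
    (h : IsReducedWord P (u :: w)) : IsReducedWord P w :=
  ⟨(List.isChain_cons.1 h.1).2, fun v hv => h.2 v (List.mem_cons_of_mem _ hv)⟩

theorem exists_isReducedWord_pow_mul [DecidableEq α] {H : Type*} [Group H] {P : α → ℕ} {x : α → H}
    (hx : ∀ c, x c ^ P c = 1) (c : α) (i : ℕ) {w : List (α × ℕ)} (hw : IsReducedWord P w) :
    ∃ w', IsReducedWord P w' ∧ x c ^ i * evalWord x w = evalWord x w' := by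
  have pow_eq_one : ∀ j, P c ∣ j → x c ^ j = 1 := by
    rintro _ ⟨t, rfl⟩
    rw [pow_mul, hx, one_pow]
  by_cases hi : P c ∣ i
  · exact ⟨w, hw, by rw [pow_eq_one i hi, one_mul]⟩
  rcases w with _ | ⟨⟨d, e⟩, w⟩
  · exact ⟨[(c, i)], ⟨by simp, by simpa using hi⟩, by simp [evalWord]⟩
  by_cases hcd : c = d
  · subst hcd
    have heval : x c ^ i * evalWord x ((c, e) :: w) = x c ^ (i + e) * evalWord x w := by
      simp [evalWord, pow_add, mul_assoc]
    by_cases hie : P c ∣ i + e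
    · exact ⟨w, hw.tail, by rw [heval, pow_eq_one _ hie, one_mul]⟩
    · refine ⟨(c, i + e) :: w, ⟨List.isChain_cons.2 (List.isChain_cons.1 hw.1), ?_⟩,
        by rw [heval]; simp [evalWord]⟩
      intro u hu
      rcases List.mem_cons.1 hu with rfl | hu
      · exact hie
      · exact hw.tail.2 u hu
  · refine ⟨(c, i) :: (d, e) :: w, ⟨List.isChain_cons_cons.2 ⟨hcd, hw.1⟩, ?_⟩, by simp [evalWord]⟩
    intro u hu
    rcases List.mem_cons.1 hu with rfl | hu
    · exact hi
    · exact hw.2 u hu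

theorem exists_isReducedWord_eq_evalWord [DecidableEq α] {H : Type*} [Group H] {P : α → ℕ}
    {x : α → H} (hP : ∀ c, 0 < P c) (hx : ∀ c, x c ^ P c = 1)
    (hgen : Subgroup.closure (Set.range x) = ⊤) (h : H) :
    ∃ w, IsReducedWord P w ∧ h = evalWord x w := by
  have hmem : h ∈ Subgroup.closure (Set.range x) := hgen ▸ Subgroup.mem_top h
  induction hmem using Subgroup.closure_induction_left with
  | one => exact ⟨[], ⟨by simp, by simp⟩, by simp [evalWord]⟩
  | mul_left y hy z _ ih =>
    obtain ⟨c, rfl⟩ := hy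
    obtain ⟨w, hw, rfl⟩ := ih
    obtain ⟨w', hw', h'⟩ := exists_isReducedWord_pow_mul hx c 1 hw
    exact ⟨w', hw', by rw [← h', pow_one]⟩
  | inv_mul_cancel y hy z _ ih =>
    obtain ⟨c, rfl⟩ := hy
    obtain ⟨w, hw, rfl⟩ := ih
    obtain ⟨w', hw', h'⟩ := exists_isReducedWord_pow_mul hx c (P c - 1) hw
    refine ⟨w', hw', ?_⟩
    rw [← h', inv_eq_of_mul_eq_one_left (a := x c ^ (P c - 1))]
    rw [← pow_succ, Nat.sub_add_cancel (hP c), hx]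

/-- The monomial of lowest degree in which the product `(1 + c₁) ^ e₁ * (1 + c₂) ^ e₂ * ⋯` involves
all syllables, in characteristic `p`. -/
def leadingMonomial (p : ℕ) (w : List (α × ℕ)) : List α :=
  (w.map fun u => List.replicate (p ^ padicValNat p u.2) u.1).flatten

theorem leadingMonomial_cons (p : ℕ) (c : α) (e : ℕ) (w : List (α × ℕ)) :
    leadingMonomial p ((c, e) :: w) =
      List.replicate (p ^ padicValNat p e) c ++ leadingMonomial p w := by
  simp [leadingMonomial]

end ReducedWords

section MagnusRepresentation

variable {α : Type*} [DecidableEq α]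

/-- The number of leading letters of a list that are equal to `c`. -/
def leadingCount (c : α) : List α → ℕ
  | [] => 0
  | d :: V => if d = c then leadingCount c V + 1 else 0

/-- The number of positions at which the letter changes along the list `c :: V`. -/
def changeCount : α → List α → ℕ
  | _, [] => 0
  | c, d :: V => if d = c then changeCount c V else changeCount d V + 1

theorem changeCount_le (c d : α) (V : List α) : changeCount c V ≤ changeCount d V + 1 := by
  cases V with
  | nil => simp [changeCount]
  | cons e V =>
    simp only [changeCount]
    split_ifs <;> subst_vars <;> omega

theorem changeCount_replicate_append_self (c : α) (m : ℕ) (V : List α) :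
    changeCount c (List.replicate m c ++ V) = changeCount c V := by
  induction m with
  | zero => simp
  | succ m ih => simpa [List.replicate_succ, changeCount] using ih

theorem changeCount_replicate_append {c d : α} (hcd : d ≠ c) {m : ℕ} (hm : 0 < m) (V : List α) :
    changeCount c (List.replicate m d ++ V) = changeCount d V + 1 := by
  obtain ⟨m, rfl⟩ := Nat.exists_eq_succ_of_ne_zero hm.ne'
  simp [List.replicate_succ, changeCount, hcd, changeCount_replicate_append_self]

theorem leadingCount_replicate_append_self (c : α) (m : ℕ) (V : List α) :
    leadingCount c (List.replicate m c ++ V) = m + leadingCount c V := by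
  induction m with
  | zero => simp
  | succ m ih => simp [List.replicate_succ, leadingCount, ih]; omega

theorem leadingCount_replicate_append {c d : α} (hcd : d ≠ c) {m : ℕ} (hm : 0 < m) (V : List α) :
    leadingCount c (List.replicate m d ++ V) = 0 := by
  obtain ⟨m, rfl⟩ := Nat.exists_eq_succ_of_ne_zero hm.ne'
  simp [List.replicate_succ, leadingCount, hcd]

/-- Functions on the lists of length at most `N`, viewed as truncated noncommutative polynomials. -/
abbrev TruncatedPoly (R α : Type*) (N : ℕ) : Type _ := {V : List α // V.length ≤ N} → R

/-- Left multiplication by the letter `c` on truncated noncommutative polynomials, modulo the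
monomials that contain `P c` consecutive letters `c`. -/
def letterMul (R : Type*) [Ring R] (P : α → ℕ) (N : ℕ) (c : α) :
    Module.End R (TruncatedPoly R α N) where
  toFun f V := match V with
    | ⟨[], _⟩ => 0
    | ⟨d :: V, h⟩ =>
      if d = c ∧ leadingCount c V + 1 < P c then f ⟨V, (Nat.le_succ _).trans h⟩ else 0
  map_add' f g := by
    ext ⟨V, h⟩
    rcases V with _ | ⟨d, V⟩
    · simp
    · simp only [Pi.add_apply]
      split_ifs <;> simp
  map_smul' r f := by
    ext ⟨V, h⟩
    rcases V with _ | ⟨d, V⟩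
    · simp
    · simp only [Pi.smul_apply, RingHom.id_apply]
      split_ifs <;> simp

variable {R : Type*} [Ring R] {P : α → ℕ} {N : ℕ}

theorem letterMul_cons (c d : α) (f : TruncatedPoly R α N) (V : List α)
    (h : (d :: V).length ≤ N) :
    letterMul R P N c f ⟨d :: V, h⟩ =
      if d = c ∧ leadingCount c V + 1 < P c then f ⟨V, (Nat.le_succ _).trans h⟩ else 0 := rfl

theorem letterMul_pow_apply_of_leadingCount_lt (c : α) (f : TruncatedPoly R α N) {r : ℕ}
    {V : List α} (h : V.length ≤ N) (hr : leadingCount c V < r) :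
    (letterMul R P N c ^ r) f ⟨V, h⟩ = 0 := by
  induction r generalizing V with
  | zero => omega
  | succ r ih =>
    rw [pow_succ', Module.End.mul_apply]
    rcases V with _ | ⟨d, V⟩
    · rfl
    · rw [letterMul_cons]
      split_ifs with hd
      · refine ih _ ?_
        simp only [leadingCount, hd.1, if_true] at hr
        omega
      · rfl

theorem letterMul_pow_eq_zero (c : α) (hc : 0 < P c) : letterMul R P N c ^ P c = 0 := by
  ext f ⟨V, h⟩
  by_cases hV : leadingCount c V < P c
  · exact letterMul_pow_apply_of_leadingCount_lt c f h hV
  · rw [← Nat.sub_add_cancel hc, pow_succ', Module.End.mul_apply]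
    rcases V with _ | ⟨d, V⟩
    · rfl
    · rw [letterMul_cons, if_neg]
      · rfl
      · rintro ⟨rfl, hlt⟩
        simp only [leadingCount, if_true] at hV
        omega

theorem letterMul_pow_apply_replicate_append (c : α) (f : TruncatedPoly R α N) {r : ℕ}
    {V : List α} (h : (List.replicate r c ++ V).length ≤ N) (h' : V.length ≤ N)
    (hr : r + leadingCount c V < P c) :
    (letterMul R P N c ^ r) f ⟨List.replicate r c ++ V, h⟩ = f ⟨V, h'⟩ := by
  induction r with
  | zero => rfl
  | succ r ih =>
    rw [pow_succ', Module.End.mul_apply]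
    simp only [List.replicate_succ, List.cons_append] at h ⊢
    rw [letterMul_cons, if_pos ⟨rfl, by rw [leadingCount_replicate_append_self]; omega⟩]
    exact ih _ (by omega)

/-- The truncated polynomials supported on the monomials `V` such that the letter changes at most
`n` times along `c :: V`. -/
def changeCountSubmodule (R : Type*) [Ring R] (N : ℕ) (c : α) (n : ℕ) :
    Submodule R (TruncatedPoly R α N) where
  carrier := {f | ∀ V, n < changeCount c V.1 → f V = 0}
  zero_mem' _ _ := rfl
  add_mem' hf hg V hV := by simp [hf V hV, hg V hV]
  smul_mem' r f hf V hV := by simp [hf V hV]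

theorem letterMul_mem_changeCountSubmodule (c : α) (n : ℕ) {f : TruncatedPoly R α N}
    (hf : f ∈ changeCountSubmodule R N c n) :
    letterMul R P N c f ∈ changeCountSubmodule R N c n := by
  rintro ⟨V, h⟩ hV
  rcases V with _ | ⟨d, V⟩
  · rfl
  · rw [letterMul_cons]
    split_ifs with hd
    · obtain ⟨rfl, -⟩ := hd
      exact hf _ (by simpa [changeCount] using hV)
    · rfl

theorem one_add_letterMul_pow_mem_changeCountSubmodule (c : α) (n e : ℕ)
    {f : TruncatedPoly R α N} (hf : f ∈ changeCountSubmodule R N c n) :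
    ((1 + letterMul R P N c) ^ e) f ∈ changeCountSubmodule R N c n := by
  induction e with
  | zero => simpa using hf
  | succ e ih =>
    rw [pow_succ', Module.End.mul_apply, LinearMap.add_apply, Module.End.one_apply]
    exact add_mem ih (letterMul_mem_changeCountSubmodule c n ih)

theorem evalWord_mem_changeCountSubmodule {f : TruncatedPoly R α N}
    (hf : ∀ c, f ∈ changeCountSubmodule R N c 0) (w : List (α × ℕ)) (d : α) :
    evalWord (fun c => 1 + letterMul R P N c) w f ∈ changeCountSubmodule R N d w.length := by
  induction w generalizing d with
  | nil => simpa [evalWord] using hf d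
  | cons u w ih =>
    simp only [evalWord, List.map_cons, List.prod_cons, Module.End.mul_apply, List.length_cons]
    intro V hV
    refine one_add_letterMul_pow_mem_changeCountSubmodule u.1 w.length u.2 (ih u.1) V ?_
    have := changeCount_le d u.1 V.1
    omega

theorem exists_one_add_pow_eq (T : R) (n : ℕ) : ∃ Y, (1 + T) ^ n = 1 + n * T + T ^ 2 * Y := by
  induction n with
  | zero => exact ⟨0, by simp⟩
  | succ n ih =>
    obtain ⟨Y, hY⟩ := ih
    refine ⟨n + Y + T * Y, ?_⟩
    rw [pow_succ', hY]
    have hcomm : T * (n : R) = n * T := (Nat.cast_commute n T).symm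
    have hcomm' : T ^ 2 * (n : R) = n * T ^ 2 := (Nat.cast_commute n _).symm
    push_cast
    simp only [mul_add, add_mul, hcomm', mul_one, one_mul]
    rw [← mul_assoc T (n : R), hcomm, pow_two]
    noncomm_ring

variable {p : ℕ} [hp : Fact p.Prime]

theorem changeCount_leadingMonomial {c : α} {w : List (α × ℕ)}
    (hw : w.IsChain fun u v => u.1 ≠ v.1) (hc : ∀ u ∈ w.head?, c ≠ u.1) :
    changeCount c (leadingMonomial p w) = w.length := by
  induction w generalizing c with
  | nil => rfl
  | cons u w ih =>
    obtain ⟨d, e⟩ := u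
    have hw := List.isChain_cons.1 hw
    rw [leadingMonomial_cons, changeCount_replicate_append (by simpa [eq_comm] using hc)
      (pow_pos hp.out.pos _), ih hw.2 hw.1, List.length_cons]

theorem leadingCount_leadingMonomial {c : α} {w : List (α × ℕ)} (hc : ∀ u ∈ w.head?, c ≠ u.1) :
    leadingCount c (leadingMonomial p w) = 0 := by
  rcases w with _ | ⟨⟨d, e⟩, w⟩
  · rfl
  · rw [leadingMonomial_cons, leadingCount_replicate_append (by simpa [eq_comm] using hc)
      (pow_pos hp.out.pos _)]

instance (N : ℕ) : CharP (Module.End (ZMod p) (TruncatedPoly (ZMod p) α N)) p :=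
  haveI : Nonempty {V : List α // V.length ≤ N} := ⟨⟨[], Nat.zero_le N⟩⟩
  charP_of_injective_algebraMap (algebraMap (ZMod p) _).injective p

theorem one_add_letterMul_pow_prime_pow (κ : α → ℕ) (N : ℕ) (c : α) :
    (1 + letterMul (ZMod p) (fun c => p ^ κ c) N c) ^ p ^ κ c = 1 := by
  rw [add_pow_char_pow_of_commute p _ (Commute.one_left _), one_pow,
    letterMul_pow_eq_zero (P := fun c => p ^ κ c) c (pow_pos hp.out.pos _), add_zero]

theorem evalWord_apply_leadingMonomial_ne_zero [Nontrivial α] (κ : α → ℕ)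
    {f : TruncatedPoly (ZMod p) α N} (hf : ∀ c, f ∈ changeCountSubmodule (ZMod p) N c 0)
    (hf_nil : f ⟨[], Nat.zero_le N⟩ ≠ 0) {w : List (α × ℕ)}
    (hw : IsReducedWord (fun c => p ^ κ c) w) (hN : (leadingMonomial p w).length ≤ N) :
    evalWord (fun c => 1 + letterMul (ZMod p) (fun c => p ^ κ c) N c) w f
      ⟨leadingMonomial p w, hN⟩ ≠ 0 := by
  induction w with
  | nil => simpa [evalWord, leadingMonomial] using hf_nil
  | cons u w ih =>
    obtain ⟨c, e⟩ := u
    have hN' : (leadingMonomial p w).length ≤ N := by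
      rw [leadingMonomial_cons, List.length_append] at hN
      omega
    have hchain := List.isChain_cons.1 hw.1
    have he : ¬ p ^ κ c ∣ e := hw.2 (c, e) (by simp)
    have he0 : e ≠ 0 := by
      rintro rfl
      exact he (dvd_zero _)
    set m := p ^ padicValNat p e with hm
    obtain ⟨u, hu⟩ : m ∣ e := pow_padicValNat_dvd
    have hm_pos : 0 < m := pow_pos hp.out.pos _
    have hm_lt : m < p ^ κ c := by
      refine Nat.pow_lt_pow_right hp.out.one_lt ?_
      by_contra! hle
      exact he ((pow_dvd_pow p hle).trans pow_padicValNat_dvd)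
    have hpu : (u : ZMod p) ≠ 0 := by
      rw [Ne, ZMod.natCast_eq_zero_iff]
      intro hdvd
      refine pow_succ_padicValNat_not_dvd (p := p) he0 ?_
      have hdvd' := mul_dvd_mul_left m hdvd
      rwa [← hu, hm, ← pow_succ] at hdvd'
    set S := letterMul (ZMod p) (fun c => p ^ κ c) N c
    set g := evalWord (fun c => 1 + letterMul (ZMod p) (fun c => p ^ κ c) N c) w f
    obtain ⟨Y, hY⟩ := exists_one_add_pow_eq (S ^ m) u
    have hpow : (1 + S) ^ e = 1 + u * S ^ m + S ^ (2 * m) * Y := by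
      conv_lhs => rw [hu]
      rw [pow_mul, hm, add_pow_char_pow_of_commute p _ (Commute.one_left _), one_pow, ← hm, hY,
        ← pow_mul, mul_comm m 2]
    have heval : evalWord (fun c => 1 + letterMul (ZMod p) (fun c => p ^ κ c) N c) ((c, e) :: w) f =
        g + (u : ZMod p) • (S ^ m) g + (S ^ (2 * m)) (Y g) := by
      simp only [evalWord, List.map_cons, List.prod_cons, Module.End.mul_apply]
      change ((1 + S) ^ e) g = _
      rw [hpow]
      simp [LinearMap.add_apply, Nat.cast_smul_eq_nsmul]
    rw [heval]
    simp only [leadingMonomial_cons, Pi.add_apply, Pi.smul_apply, smul_eq_mul]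
    have hlead := leadingCount_leadingMonomial (p := p) hchain.1
    rw [letterMul_pow_apply_replicate_append c g _ hN' (by rw [hlead]; exact hm_lt),
      letterMul_pow_apply_of_leadingCount_lt, add_zero]
    · obtain ⟨d, hd⟩ := exists_ne c
      have hg_zero : g ⟨List.replicate (p ^ padicValNat p e) c ++ leadingMonomial p w,
          leadingMonomial_cons p c e w ▸ hN⟩ = 0 :=
        evalWord_mem_changeCountSubmodule (P := fun c => p ^ κ c) hf w d _ (by
            rw [changeCount_replicate_append hd.symm hm_pos,
              changeCount_leadingMonomial hchain.2 hchain.1]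
            exact Nat.lt_succ_self _)
      rw [hg_zero, zero_add]
      exact mul_ne_zero hpu (ih hw.tail hN')
    · rw [leadingCount_replicate_append_self, hlead]
      omega

end MagnusRepresentation

section UnipotentGroup

variable {α : Type*} {p : ℕ} {N : ℕ}

/-- An endomorphism of the truncated polynomials is unipotent if it does not change the terms of
lowest degree. -/
def IsUnipotent {R : Type*} [Ring R] (T : Module.End R (TruncatedPoly R α N)) : Prop :=
  ∀ (k : ℕ) (f : TruncatedPoly R α N), (∀ V, V.1.length < k → f V = 0) →
    ∀ V, V.1.length < k + 1 → T f V = f V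

theorem IsUnipotent.mul {R : Type*} [Ring R] {S T : Module.End R (TruncatedPoly R α N)}
    (hS : IsUnipotent S) (hT : IsUnipotent T) : IsUnipotent (S * T) := by
  intro k f hf V hV
  rw [Module.End.mul_apply, hS k (T f) (fun W hW => ?_) V hV, hT k f hf V hV]
  rw [hT k f hf W (by omega), hf W hW]

theorem IsUnipotent.pow {R : Type*} [Ring R] {T : Module.End R (TruncatedPoly R α N)}
    (hT : IsUnipotent T) (n : ℕ) : IsUnipotent (T ^ n) := by
  induction n with
  | zero => exact fun _ _ _ _ _ => rfl
  | succ n ih => exact pow_succ T n ▸ ih.mul hT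

theorem isUnipotent_one_add_letterMul [DecidableEq α] {R : Type*} [Ring R] (P : α → ℕ) (c : α) :
    IsUnipotent (1 + letterMul R P N c) := by
  rintro k f hf ⟨V, h⟩ hV
  rw [LinearMap.add_apply, Module.End.one_apply, Pi.add_apply, add_eq_left]
  rcases V with _ | ⟨d, V⟩
  · rfl
  · rw [letterMul_cons]
    split_ifs
    · exact hf _ (by simpa using hV)
    · rfl

variable [hp : Fact p.Prime]

theorem IsUnipotent.pow_prime_pow_eq_one {T : Module.End (ZMod p) (TruncatedPoly (ZMod p) α N)}
    (hT : IsUnipotent T) : T ^ p ^ (N + 1) = 1 := by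
  have hvanish : ∀ (k : ℕ) (f : TruncatedPoly (ZMod p) α N) V, V.1.length < k →
      ((T - 1) ^ k) f V = 0 := by
    intro k f
    induction k with
    | zero => simp
    | succ k ih =>
      intro V hV
      rw [pow_succ', Module.End.mul_apply, LinearMap.sub_apply, Module.End.one_apply, Pi.sub_apply,
        hT k _ ih V hV, sub_self]
  have hnil : (T - 1) ^ (N + 1) = 0 := by
    ext f V
    exact hvanish (N + 1) f V (Nat.lt_succ_of_le V.2)
  have hle : N + 1 ≤ p ^ (N + 1) := (Nat.lt_pow_self hp.out.one_lt).le
  have h := add_pow_char_pow_of_commute p (N + 1) (Commute.one_right (T - 1))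
  rwa [sub_add_cancel, one_pow, pow_eq_zero_of_le hle hnil, zero_add] at h

variable (α p N) in
/-- The group of unipotent automorphisms of the truncated polynomials over `ZMod p`. -/
def unipotentGroup : Subgroup (Module.End (ZMod p) (TruncatedPoly (ZMod p) α N))ˣ where
  carrier := {u | IsUnipotent u.1}
  one_mem' _ _ _ _ _ := rfl
  mul_mem' hS hT := IsUnipotent.mul hS hT
  inv_mem' {u} hu := by
    have hu_pow : u ^ p ^ (N + 1) = 1 := Units.ext (by simpa using hu.pow_prime_pow_eq_one)
    have hinv : u⁻¹ = u ^ (p ^ (N + 1) - 1) := by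
      rw [inv_eq_iff_mul_eq_one, ← pow_succ', Nat.sub_add_cancel (pow_pos hp.out.pos _), hu_pow]
    rw [hinv]
    exact hu.pow _

theorem isPGroup_unipotentGroup : IsPGroup p (unipotentGroup α p N) := fun u =>
  ⟨N + 1, Subtype.ext (Units.ext (by simpa using IsUnipotent.pow_prime_pow_eq_one u.2))⟩

instance [Finite α] : Finite (unipotentGroup α p N) := by
  have : Finite {V : List α // V.length ≤ N} := List.finite_length_le α N
  have : Finite (Module.End (ZMod p) (TruncatedPoly (ZMod p) α N)) :=
    Finite.of_injective _ (DFunLike.coe_injective (F := Module.End (ZMod p) _))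
  infer_instance

end UnipotentGroup

/-- Free products of finite cyclic `p`-groups are residually finite `p`-groups: every nonempty
reduced word takes a nontrivial value in some finite `p`-group. -/
theorem exists_isPGroup_evalWord_ne_one {α : Type} [DecidableEq α] [Finite α] [Nontrivial α] {p : ℕ}
    [hp : Fact p.Prime] (κ : α → ℕ) {w : List (α × ℕ)}
    (hw : IsReducedWord (fun c => p ^ κ c) w) (hw_ne : w ≠ []) :
    ∃ (T : Type) (_ : Group T) (_ : Finite T) (x : α → T),
      IsPGroup p T ∧ (∀ c, x c ^ p ^ κ c = 1) ∧ evalWord x w ≠ 1 := by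
  classical
  let N := (leadingMonomial p w).length
  let y : α → (Module.End (ZMod p) (TruncatedPoly (ZMod p) α N))ˣ := fun c =>
    Units.ofPowEqOne _ (p ^ κ c) (one_add_letterMul_pow_prime_pow κ N c)
      (pow_pos hp.out.pos _).ne'
  have hy : ∀ c, y c ∈ unipotentGroup α p N := fun c => isUnipotent_one_add_letterMul _ c
  refine ⟨unipotentGroup α p N, inferInstance, inferInstance, fun c => ⟨y c, hy c⟩,
    isPGroup_unipotentGroup, fun c => Subtype.ext (Units.pow_ofPowEqOne
      (one_add_letterMul_pow_prime_pow κ N c) (pow_pos hp.out.pos _).ne'), fun h => ?_⟩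
  let f : TruncatedPoly (ZMod p) α N := Pi.single ⟨[], Nat.zero_le N⟩ 1
  have hf : ∀ c, f ∈ changeCountSubmodule (ZMod p) N c 0 := by
    rintro c ⟨V, hV⟩ hlt
    refine Pi.single_eq_of_ne ?_ _
    rintro ⟨⟩
    simp [changeCount] at hlt
  have hne := evalWord_apply_leadingMonomial_ne_zero κ hf (by simp [f]) hw le_rfl
  have heval := congrArg ((Units.coeHom _).comp (unipotentGroup α p N).subtype) h
  rw [map_evalWord, map_one] at heval
  change evalWord (fun c => 1 + letterMul (ZMod p) (fun c => p ^ κ c) N c) w = 1 at heval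
  rw [heval] at hne
  refine hne (Pi.single_eq_of_ne ?_ _)
  rcases w with _ | ⟨⟨c, e⟩, w⟩
  · exact absurd rfl hw_ne
  · intro h
    have := congrArg (fun V => V.1.length) h
    simp [leadingMonomial_cons, hp.out.ne_zero] at this

section NpOmega

universe u

variable {p : ℕ} {G : Type u} [Group G]

theorem mem_NpOmega {g : G} :
    g ∈ NpOmega p G ↔ ∀ M : Subgroup G, M.Normal → (∃ n, M.index = p ^ n) → g ∈ M := by
  simp only [NpOmega, Subgroup.mem_iInf, Set.mem_ofPred_eq, and_imp]

instance : (NpOmega p G).Normal where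
  conj_mem g hg h := mem_NpOmega.2 fun M hM hn => hM.conj_mem g (mem_NpOmega.1 hg M hM hn) h

theorem mem_NpOmega_of_forall_map_eq_one {g : G}
    (h : ∀ (T : Type u) [Group T], IsPGroup p T → ∀ φ : G →* T, φ g = 1) : g ∈ NpOmega p G := by
  refine mem_NpOmega.2 fun M hM ⟨n, hn⟩ => ?_
  rw [← QuotientGroup.eq_one_iff]
  exact h (G ⧸ M) (IsPGroup.of_card hn) (QuotientGroup.mk' M)

variable [hp : Fact p.Prime]

theorem map_eq_one_of_mem_NpOmega {T : Type*} [Group T] [Finite T] (hT : IsPGroup p T)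
    (φ : G →* T) {g : G} (hg : g ∈ NpOmega p G) : φ g = 1 := by
  refine mem_NpOmega.1 hg φ.ker inferInstance ?_
  rw [Subgroup.index_ker]
  exact IsPGroup.iff_card.1 (hT.to_subgroup φ.range)

theorem map_int_eq_one_of_mem_NpOmega (φ : G →* Multiplicative ℤ) {g : G} (hg : g ∈ NpOmega p G) :
    φ g = 1 := by
  set z := (φ g).toAdd
  suffices z = 0 from this
  by_contra hne
  let n := z.natAbs
  have : NeZero (p ^ n) := ⟨(pow_pos hp.out.pos n).ne'⟩
  have h := map_eq_one_of_mem_NpOmega (T := Multiplicative (ZMod (p ^ n)))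
    (IsPGroup.of_card (n := n) (by simp))
    ((AddMonoidHom.toMultiplicative (Int.castAddHom (ZMod (p ^ n)))).comp φ) hg
  have h' : ((z : ℤ) : ZMod (p ^ n)) = 0 := h
  rw [ZMod.intCast_zmod_eq_zero_iff_dvd] at h'
  have hle := Nat.le_of_dvd (Int.natAbs_pos.2 hne) (Int.natCast_dvd.1 h')
  exact absurd hle (Nat.lt_pow_self hp.out.one_lt).not_ge

end NpOmega

theorem IsPGroup.commute_of_commute_pow {p : ℕ} {T : Type*} [Group T] (hT : IsPGroup p T) {n : ℕ}
    (hn : p.Coprime n) {x y : T} (h : Commute x (y ^ n)) : Commute x y := by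
  have hconj : (x * y * x⁻¹) ^ n = y ^ n := by rw [conj_pow, h.eq, mul_inv_cancel_right]
  exact mul_inv_eq_iff_eq_mul.1 ((hT.powEquiv hn).injective hconj)

theorem inv_mul_inv_mul_mul_eq_one_iff_commute {T : Type*} [Group T] {x y : T} :
    x⁻¹ * y⁻¹ * x * y = 1 ↔ Commute x y := by
  rw [mul_assoc, ← mul_inv_rev, inv_mul_eq_one]
  exact eq_comm

theorem mem_center_of_closure_eq_top {T : Type*} [Group T] {S : Set T}
    (hS : Subgroup.closure S = ⊤) {z : T} (hz : ∀ s ∈ S, Commute s z) : z ∈ Subgroup.center T := by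
  rw [← Subgroup.centralizer_univ, ← Subgroup.coe_top, ← hS, Subgroup.centralizer_closure]
  exact Subgroup.mem_centralizer_iff.2 hz

theorem zpowers_normal_of_mem_center {T : Type*} [Group T] {z : T} (hz : z ∈ Subgroup.center T) :
    (Subgroup.zpowers z).Normal where
  conj_mem n hn g := by
    rwa [Subgroup.mem_center_iff.1 (Subgroup.zpowers_le.2 hz hn) g, mul_inv_cancel_right]

/-- If `G` surjects onto the free product of the cyclic groups of orders `p ^ κ c`, then
`(N_p)_ω(G)` is contained in the kernel. -/
theorem NpOmega_le_normalClosure_pow {p : ℕ} [hp : Fact p.Prime] {G : Type*} [Group G] {α : Type}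
    [Finite α] [Nontrivial α] (κ : α → ℕ) {x : α → G} (hx : Subgroup.closure (Set.range x) = ⊤)
    (hlift : ∀ (T : Type) [Group T] (y : α → T), (∀ c, y c ^ p ^ κ c = 1) →
      ∃ φ : G →* T, ∀ c, φ (x c) = y c) :
    NpOmega p G ≤ Subgroup.normalClosure (Set.range fun c => x c ^ p ^ κ c) := by
  classical
  intro g hg
  set L := Subgroup.normalClosure (Set.range fun c => x c ^ p ^ κ c)
  have hgen : Subgroup.closure (Set.range fun c => (x c : G ⧸ L)) = ⊤ := by
    have h := MonoidHom.map_closure (QuotientGroup.mk' L) (Set.range x)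
    rw [hx, Subgroup.map_top_of_surjective _ (QuotientGroup.mk'_surjective L), ← Set.range_comp] at h
    exact h.symm
  have hpow : ∀ c, (x c : G ⧸ L) ^ p ^ κ c = 1 := fun c =>
    (QuotientGroup.eq_one_iff (x c ^ p ^ κ c)).2 (Subgroup.subset_normalClosure ⟨c, rfl⟩)
  obtain ⟨w, hw, hgw⟩ := exists_isReducedWord_eq_evalWord (P := fun c => p ^ κ c)
    (fun c => pow_pos hp.out.pos _) hpow hgen (g : G ⧸ L)
  rcases eq_or_ne w [] with rfl | hw_ne
  · exact (QuotientGroup.eq_one_iff g).1 hgw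
  obtain ⟨T, _, _, y, hT, hy, hne⟩ := exists_isPGroup_evalWord_ne_one κ hw hw_ne
  obtain ⟨φ, hφ⟩ := hlift T y hy
  have hLφ : L ≤ φ.ker := by
    refine Subgroup.normalClosure_le_normal ?_
    rintro _ ⟨c, rfl⟩
    simp [MonoidHom.mem_ker, hφ, hy]
  have hmem : g⁻¹ * evalWord x w ∈ L := by
    rw [← QuotientGroup.eq, hgw]
    exact (map_evalWord (QuotientGroup.mk' L) x w).symm
  have h1 := hLφ hmem
  rw [MonoidHom.mem_ker, map_mul, map_inv, map_eq_one_of_mem_NpOmega hT φ hg, inv_one, one_mul,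
    map_evalWord] at h1
  simp only [hφ] at h1
  exact absurd h1 hne

section GBS

variable {k l : ℕ}

theorem genA_pow_eq_genB_pow (k l : ℕ) : genA k l ^ k = genB k l ^ l := by
  rw [← mul_inv_eq_one]
  exact PresentedGroup.one_of_mem (rels := {FreeGroup.of 0 ^ k * (FreeGroup.of 1 ^ l)⁻¹}) rfl

theorem exists_GBS_hom {T : Type*} [Group T] (y : Fin 2 → T) (h : y 0 ^ k = y 1 ^ l) :
    ∃ φ : GBS k l →* T, ∀ c, φ (PresentedGroup.of c) = y c := by
  refine ⟨PresentedGroup.toGroup (f := y) ?_, fun c => PresentedGroup.toGroup.of _⟩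
  rintro _ rfl
  simp [h]

end GBS

theorem NpOmega_GBS_le {p : ℕ} [hp : Fact p.Prime] {κ μ d k₂ l₂ : ℕ} (hk₂ : 0 < k₂)
    (hcop : Nat.Coprime k₂ l₂) :
    NpOmega p (GBS (p ^ κ * (k₂ * d)) (p ^ μ * (l₂ * d))) ≤
      Subgroup.normalClosure
        {genA (p ^ κ * (k₂ * d)) (p ^ μ * (l₂ * d)) ^ (p ^ κ * k₂) *
            (genB (p ^ κ * (k₂ * d)) (p ^ μ * (l₂ * d)) ^ (p ^ μ * l₂))⁻¹,
         (genA (p ^ κ * (k₂ * d)) (p ^ μ * (l₂ * d)))⁻¹ *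
            (genB (p ^ κ * (k₂ * d)) (p ^ μ * (l₂ * d)) ^ p ^ μ)⁻¹ *
            genA (p ^ κ * (k₂ * d)) (p ^ μ * (l₂ * d)) *
            genB (p ^ κ * (k₂ * d)) (p ^ μ * (l₂ * d)) ^ p ^ μ,
         (genA (p ^ κ * (k₂ * d)) (p ^ μ * (l₂ * d)) ^ p ^ κ)⁻¹ *
            (genB (p ^ κ * (k₂ * d)) (p ^ μ * (l₂ * d)))⁻¹ *
            genA (p ^ κ * (k₂ * d)) (p ^ μ * (l₂ * d)) ^ p ^ κ *
            genB (p ^ κ * (k₂ * d)) (p ^ μ * (l₂ * d))} := by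
  set k := p ^ κ * (k₂ * d) with hk
  set l := p ^ μ * (l₂ * d) with hl
  set a := genA k l
  set b := genB k l
  set K : Subgroup (GBS k l) := Subgroup.normalClosure _
  intro g hg
  have hgen : Subgroup.closure (Set.range (PresentedGroup.of : Fin 2 → GBS k l)) = ⊤ :=
    PresentedGroup.closure_range_of _
  have hgL := NpOmega_le_normalClosure_pow ![κ, μ] hgen (fun T _ y hy => exists_GBS_hom y (by
      have h0 : y 0 ^ p ^ κ = 1 := hy 0
      have h1 : y 1 ^ p ^ μ = 1 := hy 1
      rw [hk, hl, pow_mul, pow_mul _ (p ^ μ), h0, h1, one_pow, one_pow])) hg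
  set A : GBS k l ⧸ K := (a : GBS k l ⧸ K)
  set B : GBS k l ⧸ K := (b : GBS k l ⧸ K)
  have hAB : A ^ (p ^ κ * k₂) = B ^ (p ^ μ * l₂) := by
    rw [← mul_inv_eq_one]
    exact (QuotientGroup.eq_one_iff _).2 (Subgroup.subset_normalClosure (by simp))
  have hA_comm : Commute A (B ^ p ^ μ) := by
    rw [← inv_mul_inv_mul_mul_eq_one_iff_commute]
    exact (QuotientGroup.eq_one_iff _).2 (Subgroup.subset_normalClosure (by simp))
  have hB_comm : Commute (A ^ p ^ κ) B := by
    rw [← inv_mul_inv_mul_mul_eq_one_iff_commute]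
    exact (QuotientGroup.eq_one_iff _).2 (Subgroup.subset_normalClosure (by simp))
  have hgen' : Subgroup.closure (Set.range ![A, B]) = ⊤ := by
    have h := MonoidHom.map_closure (QuotientGroup.mk' K)
      (Set.range (PresentedGroup.of : Fin 2 → GBS k l))
    rw [hgen, Subgroup.map_top_of_surjective _ (QuotientGroup.mk'_surjective K),
      ← Set.range_comp] at h
    rw [h]
    congr 2
    ext c
    fin_cases c <;> rfl
  have hA_center : A ^ p ^ κ ∈ Subgroup.center (GBS k l ⧸ K) := by
    refine mem_center_of_closure_eq_top hgen' ?_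
    rintro _ ⟨c, rfl⟩
    fin_cases c
    exacts [Commute.self_pow A _, hB_comm.symm]
  have hB_center : B ^ p ^ μ ∈ Subgroup.center (GBS k l ⧸ K) := by
    refine mem_center_of_closure_eq_top hgen' ?_
    rintro _ ⟨c, rfl⟩
    fin_cases c
    exacts [hA_comm, Commute.self_pow B _]
  have hA_normal : (Subgroup.zpowers (A ^ p ^ κ)).Normal :=
    zpowers_normal_of_mem_center hA_center
  have hB_normal : (Subgroup.zpowers (B ^ p ^ μ)).Normal :=
    zpowers_normal_of_mem_center hB_center
  have hL_le : Subgroup.normalClosure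
      (Set.range fun c : Fin 2 => (PresentedGroup.of c : GBS k l) ^ p ^ ![κ, μ] c) ≤
      (Subgroup.zpowers (A ^ p ^ κ) ⊔ Subgroup.zpowers (B ^ p ^ μ)).comap
        (QuotientGroup.mk' K) := by
    refine Subgroup.normalClosure_le_normal ?_
    rintro _ ⟨c, rfl⟩
    fin_cases c
    exacts [Subgroup.mem_sup_left (Subgroup.mem_zpowers _),
      Subgroup.mem_sup_right (Subgroup.mem_zpowers _)]
  obtain ⟨_, ⟨i, rfl⟩, _, ⟨j, rfl⟩, hij⟩ := Subgroup.mem_sup_of_normal_right.1 (hL_le hgL)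
  obtain ⟨ψ, hψ⟩ := exists_GBS_hom (k := k) (l := l)
    ![Multiplicative.ofAdd ((p ^ μ * l₂ : ℕ) : ℤ), Multiplicative.ofAdd ((p ^ κ * k₂ : ℕ) : ℤ)] (by
      apply Multiplicative.toAdd.injective
      simp [hk, hl]
      ring)
  have hψa : ψ a = Multiplicative.ofAdd ((p ^ μ * l₂ : ℕ) : ℤ) := hψ 0
  have hψb : ψ b = Multiplicative.ofAdd ((p ^ κ * k₂ : ℕ) : ℤ) := hψ 1
  have hKψ : K ≤ ψ.ker := by
    refine Subgroup.normalClosure_le_normal ?_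
    rintro _ (rfl | rfl | rfl)
    · rw [SetLike.mem_coe, MonoidHom.mem_ker, map_mul, map_inv, map_pow, map_pow, hψa, hψb,
        mul_inv_eq_one]
      apply Multiplicative.toAdd.injective
      simp
      ring
    all_goals
      rw [SetLike.mem_coe, MonoidHom.mem_ker, map_mul, map_mul, map_mul, map_inv, map_inv,
        inv_mul_inv_mul_mul_eq_one_iff_commute]
      exact Commute.all _ _
  have hmem : g⁻¹ * ((a ^ p ^ κ) ^ i * (b ^ p ^ μ) ^ j) ∈ K := QuotientGroup.eq.1 hij.symm
  have hzero := hKψ hmem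
  rw [MonoidHom.mem_ker, map_mul, map_inv, map_int_eq_one_of_mem_NpOmega ψ hg, inv_one, one_mul,
    map_mul, map_zpow, map_zpow, map_pow, map_pow, hψa, hψb] at hzero
  have hlin : (p ^ κ * p ^ μ : ℤ) * (i * l₂ + j * k₂) = 0 := by
    have h := congrArg Multiplicative.toAdd hzero
    simp only [toAdd_mul, toAdd_zpow, toAdd_pow, toAdd_ofAdd, toAdd_one, smul_eq_mul, nsmul_eq_mul,
      Nat.cast_mul, Nat.cast_pow] at h
    linear_combination h
  have hp0 : (p : ℤ) ≠ 0 := Nat.cast_ne_zero.2 hp.out.ne_zero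
  have hij0 := (mul_eq_zero.1 hlin).resolve_left
    (mul_ne_zero (pow_ne_zero _ hp0) (pow_ne_zero _ hp0))
  obtain ⟨t, rfl⟩ : (k₂ : ℤ) ∣ i :=
    (Nat.isCoprime_iff_coprime.2 hcop).dvd_of_dvd_mul_right ⟨-j, by linear_combination hij0⟩
  obtain rfl : j = l₂ * (-t) := by
    refine mul_right_cancel₀ (Nat.cast_ne_zero.2 hk₂.ne' : (k₂ : ℤ) ≠ 0) ?_
    linear_combination hij0
  rw [← QuotientGroup.eq_one_iff]
  refine hij.symm.trans ?_
  simp only [zpow_mul, zpow_natCast, ← pow_mul, hAB, zpow_neg, mul_inv_cancel]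

/-- Let `p` be a prime, `k = p^κ k₁`, `l = p^λ l₁` with `p ∤ k₁`, `p ∤ l₁`, and
`d₁ = gcd(k₁, l₁)`. For `G = ⟨a, b | a^k = b^l⟩`, the intersection `(N_p)_ω(G)` of all normal
subgroups of `G` of index a finite power of `p` equals the normal closure in `G` of
`{a^{k/d₁} b^{-l/d₁}, [a, b^{p^λ}], [a^{p^κ}, b]}`. -/
theorem NpOmega_GBS (p : ℕ) (hp : p.Prime) (κ μ k₁ l₁ : ℕ) (hk₁ : 0 < k₁) (hl₁ : 0 < l₁)
    (hpk : ¬ p ∣ k₁) (hpl : ¬ p ∣ l₁) :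
    NpOmega p (GBS (p ^ κ * k₁) (p ^ μ * l₁)) =
      Subgroup.normalClosure
        {genA (p ^ κ * k₁) (p ^ μ * l₁) ^ (p ^ κ * k₁ / Nat.gcd k₁ l₁) *
            (genB (p ^ κ * k₁) (p ^ μ * l₁) ^ (p ^ μ * l₁ / Nat.gcd k₁ l₁))⁻¹,
         (genA (p ^ κ * k₁) (p ^ μ * l₁))⁻¹ *
            (genB (p ^ κ * k₁) (p ^ μ * l₁) ^ p ^ μ)⁻¹ *
            genA (p ^ κ * k₁) (p ^ μ * l₁) * genB (p ^ κ * k₁) (p ^ μ * l₁) ^ p ^ μ,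
         (genA (p ^ κ * k₁) (p ^ μ * l₁) ^ p ^ κ)⁻¹ *
            (genB (p ^ κ * k₁) (p ^ μ * l₁))⁻¹ *
            genA (p ^ κ * k₁) (p ^ μ * l₁) ^ p ^ κ * genB (p ^ κ * k₁) (p ^ μ * l₁)} := by
  have : Fact p.Prime := ⟨hp⟩
  obtain ⟨d, k₂, l₂, hd, hcop, rfl, rfl⟩ := Nat.exists_coprime' (Nat.gcd_pos_of_pos_left l₁ hk₁)
  have hpd : p.Coprime d := (hp.coprime_iff_not_dvd).2 fun h => hpk (h.mul_left k₂)
  have hk₂ : 0 < k₂ := Nat.pos_of_mul_pos_right hk₁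
  have hgcd : Nat.gcd (k₂ * d) (l₂ * d) = d := by rw [Nat.gcd_mul_right, hcop, one_mul]
  have hk_div : p ^ κ * (k₂ * d) / d = p ^ κ * k₂ := by
    rw [← mul_assoc, Nat.mul_div_cancel _ hd]
  have hl_div : p ^ μ * (l₂ * d) / d = p ^ μ * l₂ := by
    rw [← mul_assoc, Nat.mul_div_cancel _ hd]
  rw [hgcd, hk_div, hl_div]
  refine le_antisymm (NpOmega_GBS_le hk₂ hcop) (Subgroup.normalClosure_le_normal ?_)
  have hrel := genA_pow_eq_genB_pow (p ^ κ * (k₂ * d)) (p ^ μ * (l₂ * d))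
  rintro g (rfl | rfl | rfl) <;>
    refine mem_NpOmega_of_forall_map_eq_one fun T _ hT φ => ?_ <;>
    have hφ := congrArg φ hrel <;>
    simp only [map_mul, map_inv, map_pow] at hφ ⊢ <;>
    set A := φ (genA (p ^ κ * (k₂ * d)) (p ^ μ * (l₂ * d))) <;>
    set B := φ (genB (p ^ κ * (k₂ * d)) (p ^ μ * (l₂ * d)))
  · rw [mul_inv_eq_one]
    refine (hT.powEquiv hpd).injective ?_
    simpa only [IsPGroup.powEquiv_apply, ← pow_mul, mul_assoc] using hφ
  · rw [inv_mul_inv_mul_mul_eq_one_iff_commute]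
    refine hT.commute_of_commute_pow ((hp.coprime_iff_not_dvd).2 hpl) ?_
    rw [← pow_mul, ← hφ]
    exact Commute.self_pow A _
  · rw [inv_mul_inv_mul_mul_eq_one_iff_commute]
    refine (hT.commute_of_commute_pow ((hp.coprime_iff_not_dvd).2 hpk) ?_).symm
    rw [← pow_mul, hφ]
    exact Commute.self_pow B _
end
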